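/- arXiv:2412.16096 — 2 statements merged into one kernel-verified Lean document; each statement's English description precedes it below -/
import Mathlib

section
/- (Corollary on disconjugacy.) Assume the strong Atkinson condition and let ν ∈ ℝ be such that system (S_ν) is disconjugate on [0,∞) and eventually controllable. Then for every real λ ≤ ν, system (S_λ) is disconjugate on [0,∞) and possesses a recessive solution. -/
open Matrix Filter
open scoped ComplexOrder

noncomputable def Jmat (n : ℕ) : Matrix (Fin n ⊕ Fin n) (Fin n ⊕ Fin n) ℂ :=
  Matrix.fromBlocks 0 1 (-1) 0

noncomputable def PsiMat {n : ℕ} (W : ℕ → Matrix (Fin n) (Fin n) ℂ) (k : ℕ) :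
    Matrix (Fin n ⊕ Fin n) (Fin n ⊕ Fin n) ℂ :=
  Matrix.fromBlocks (W k) 0 0 0

noncomputable def Vmat {n : ℕ} (S : ℕ → Matrix (Fin n ⊕ Fin n) (Fin n ⊕ Fin n) ℂ)
    (W : ℕ → Matrix (Fin n) (Fin n) ℂ) (k : ℕ) :
    Matrix (Fin n ⊕ Fin n) (Fin n ⊕ Fin n) ℂ :=
  -(Jmat n * PsiMat W k * S k)

/-- The quadratic functional `F_λ^{[M,N]}` associated with the system, where
`𝒞ₖ(λ) = 𝒞ₖ + λ𝒲ₖ𝒜ₖ` and `𝒟ₖ(λ) = 𝒟ₖ + λ𝒲ₖℬₖ`. -/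
noncomputable def Fquad {n : ℕ} (A B C D W : ℕ → Matrix (Fin n) (Fin n) ℂ) (lam : ℝ)
    (x u : ℕ → Fin n → ℂ) (M N : ℕ) : ℂ :=
  -(∑ k ∈ Finset.Icc M N,
      (star (x (k + 1)) ⬝ᵥ (((C k + (lam : ℂ) • (W k * A k))ᴴ * A k) *ᵥ x (k + 1))
        + 2 * ((star (x (k + 1)) ⬝ᵥ (((C k + (lam : ℂ) • (W k * A k))ᴴ * B k) *ᵥ u (k + 1))).re : ℂ)
        + star (u (k + 1)) ⬝ᵥ (((D k + (lam : ℂ) • (W k * B k))ᴴ * B k) *ᵥ u (k + 1))))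

/-- System `(S_ν)` is disconjugate on `[M, N+1]`: for every admissible `z = (x; u)` on `[M,N]`
with `x_M = 0 = x_{N+1}` and `x` not identically zero on `[M,N+1]`, the value
`F_ν^{[M,N]}(z)` is a positive real number. -/
def DisconjugateOn {n : ℕ} (A B C D W : ℕ → Matrix (Fin n) (Fin n) ℂ) (nu : ℝ)
    (M N : ℕ) : Prop :=
  ∀ x u : ℕ → Fin n → ℂ,
    (∀ k, M ≤ k → k ≤ N → x k = A k *ᵥ x (k + 1) + B k *ᵥ u (k + 1)) →
    x M = 0 → x (N + 1) = 0 →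
    (∃ k, M ≤ k ∧ k ≤ N + 1 ∧ x k ≠ 0) →
    (Fquad A B C D W nu x u M N).im = 0 ∧ 0 < (Fquad A B C D W nu x u M N).re

/-- `Z` is a conjoined basis of system `(S_ν)`: a `2n×n` matrix solution with
`rank Zₖ = n` and `Zₖ* 𝒥 Zₖ = 0` for all `k`. -/
def IsConjoinedBasis {n : ℕ} (S : ℕ → Matrix (Fin n ⊕ Fin n) (Fin n ⊕ Fin n) ℂ)
    (W : ℕ → Matrix (Fin n) (Fin n) ℂ) (nu : ℝ)
    (Z : ℕ → Matrix (Fin n ⊕ Fin n) (Fin n) ℂ) : Prop :=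
  (∀ k, Z k = (S k + (nu : ℂ) • Vmat S W k) * Z (k + 1)) ∧
    ∀ k, (Z k).rank = n ∧ (Z k)ᴴ * Jmat n * Z k = 0

/-- `Z̃ = (X̃; Ũ)` is a recessive solution of `(S_ν)`: a conjoined basis such that for all
sufficiently large `k` the matrix `X̃ₖ` is invertible with `−X̃ₖ⁻¹ ℬₖ (X̃_{k+1}*)⁻¹ ≥ 0`,
and for every conjoined basis `Z = (X; U)` normalized with `Z̃` (i.e. `Zₖ* 𝒥 Z̃ₖ = I`),
the matrix `Xₖ` is invertible for all large `k` and `Xₖ⁻¹ X̃ₖ → 0` as `k → ∞`. -/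
def IsRecessive {n : ℕ} (S : ℕ → Matrix (Fin n ⊕ Fin n) (Fin n ⊕ Fin n) ℂ)
    (W B : ℕ → Matrix (Fin n) (Fin n) ℂ) (nu : ℝ)
    (Xt Ut : ℕ → Matrix (Fin n) (Fin n) ℂ) : Prop :=
  IsConjoinedBasis S W nu (fun k => Matrix.fromRows (Xt k) (Ut k)) ∧
    (∃ k₀ : ℕ, ∀ k, k₀ ≤ k →
      IsUnit (Xt k) ∧ (-((Xt k)⁻¹ * B k * ((Xt (k + 1))ᴴ)⁻¹)).PosSemidef) ∧
    ∀ X U : ℕ → Matrix (Fin n) (Fin n) ℂ,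
      IsConjoinedBasis S W nu (fun k => Matrix.fromRows (X k) (U k)) →
      (∀ k, (Matrix.fromRows (X k) (U k))ᴴ * Jmat n * Matrix.fromRows (Xt k) (Ut k) = 1) →
      (∃ k₁ : ℕ, ∀ k, k₁ ≤ k → IsUnit (X k)) ∧
        Filter.Tendsto (fun k => (X k)⁻¹ * Xt k) Filter.atTop (nhds 0)

/-- The system is eventually controllable: there is `N` such that on any finite subinterval
`{K,…,M}` of `[N,∞)` the only `u` with `0 = ℬₖ u_{k+1}` and `uₖ = 𝒟ₖ u_{k+1}` for all
`k ∈ {K,…,M−1}` is the trivial one. -/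
def EventuallyControllable {n : ℕ} (B D : ℕ → Matrix (Fin n) (Fin n) ℂ) : Prop :=
  ∃ N : ℕ, ∀ K M : ℕ, N ≤ K → K < M →
    ∀ u : ℕ → Fin n → ℂ,
      (∀ k, K ≤ k → k < M → B k *ᵥ u (k + 1) = 0 ∧ u k = D k *ᵥ u (k + 1)) →
      ∀ k, K ≤ k → k ≤ M → u k = 0

/-- The strong Atkinson (definiteness) condition: there are `λ₀ ∈ ℂ` and `a ≤ b` in `ℕ`
such that every solution `z` of `(S_{λ₀})` with `Σ_{k=a}^{b} zₖ*Ψₖzₖ = 0` vanishes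
identically. -/
def StrongAtkinson {n : ℕ} (S : ℕ → Matrix (Fin n ⊕ Fin n) (Fin n ⊕ Fin n) ℂ)
    (W : ℕ → Matrix (Fin n) (Fin n) ℂ) : Prop :=
  ∃ (lam0 : ℂ) (a b : ℕ), a ≤ b ∧
    ∀ z : ℕ → (Fin n ⊕ Fin n) → ℂ,
      (∀ k, z k = (S k + lam0 • Vmat S W k) *ᵥ z (k + 1)) →
      (∑ k ∈ Finset.Icc a b, star (z k) ⬝ᵥ (PsiMat W k *ᵥ z k)) = 0 →
      ∀ k, z k = 0


section Core

variable {n : ℕ}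

lemma aux_schur {A V : Matrix (Fin n) (Fin n) ℂ} (L : Matrix (Fin n) (Fin n) ℂ)
    (hA : A.PosDef) (hV : V.PosDef) :
    (V - Lᴴ * A⁻¹ * L).PosSemidef ↔ (A - L * V⁻¹ * Lᴴ).PosSemidef := by
  let _ := hA.isUnit.invertible
  let _ := hV.isUnit.invertible
  rw [← Matrix.PosDef.fromBlocks₁₁ L V hA, ← Matrix.PosDef.fromBlocks₂₂ A L hV]

lemma aux_inv_anti {A V : Matrix (Fin n) (Fin n) ℂ} (hA : A.PosDef)
    (h : (V - A).PosSemidef) : (A⁻¹ - V⁻¹).PosSemidef := by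
  have hV : V.PosDef := by
    have := hA.add_posSemidef h
    simpa using this
  have := (aux_schur (1 : Matrix (Fin n) (Fin n) ℂ) hA.inv hV).1
    (by
      rw [Matrix.nonsing_inv_nonsing_inv _ ((Matrix.isUnit_iff_isUnit_det _).1 hA.isUnit)]
      simpa using h)
  simpa using this

lemma aux_polar (s : Matrix (Fin n) (Fin n) ℂ) (x y : Fin n → ℂ) :
    star x ⬝ᵥ (s *ᵥ y) = (1 / 4) * (
      star (x + y) ⬝ᵥ (s *ᵥ (x + y)) - star (x - y) ⬝ᵥ (s *ᵥ (x - y))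
      - Complex.I * (star (x + Complex.I • y) ⬝ᵥ (s *ᵥ (x + Complex.I • y)))
      + Complex.I * (star (x - Complex.I • y) ⬝ᵥ (s *ᵥ (x - Complex.I • y)))) := by
  simp only [star_add, star_sub, star_smul, mulVec_add, mulVec_sub, mulVec_smul,
    add_dotProduct, sub_dotProduct, dotProduct_add, dotProduct_sub, smul_dotProduct,
    dotProduct_smul, smul_eq_mul, Complex.star_def, Complex.conj_I]
  linear_combination ((1 / 2 : ℂ) * star x ⬝ᵥ (s *ᵥ y) - (1 / 2 : ℂ) * star y ⬝ᵥ (s *ᵥ x)) * Complex.I_mul_I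

lemma aux_conv (r : ℕ → Matrix (Fin n) (Fin n) ℂ) (T : Matrix (Fin n) (Fin n) ℂ)
    (hmono : ∀ i, (r i - r (i + 1)).PosSemidef) (hb : ∀ i, (r i + T).PosSemidef) :
    ∃ R, Tendsto r atTop (nhds R) := by
  have hq : ∀ v : Fin n → ℂ, ∃ c : ℂ,
      Tendsto (fun i => star v ⬝ᵥ ((r i + T) *ᵥ v)) atTop (nhds c) := by
    intro v
    have h0 : ∀ i, 0 ≤ star v ⬝ᵥ ((r i + T) *ᵥ v) := fun i => (hb i).dotProduct_mulVec_nonneg v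
    have hanti : Antitone (fun i => (star v ⬝ᵥ ((r i + T) *ᵥ v)).re) := by
      apply antitone_nat_of_succ_le
      intro i
      have h1 := (hmono i).dotProduct_mulVec_nonneg v
      have h2 : star v ⬝ᵥ ((r i - r (i + 1)) *ᵥ v)
          = star v ⬝ᵥ ((r i + T) *ᵥ v) - star v ⬝ᵥ ((r (i + 1) + T) *ᵥ v) := by
        rw [← dotProduct_sub, ← sub_mulVec]
        congr 2
        abel
      rw [h2] at h1
      have := (Complex.le_def.1 h1).1
      simp at this
      linarith
    have hbd : BddBelow (Set.range (fun i => (star v ⬝ᵥ ((r i + T) *ᵥ v)).re)) :=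
      ⟨0, by rintro _ ⟨i, rfl⟩; exact (Complex.le_def.1 (h0 i)).1⟩
    have := tendsto_atTop_ciInf hanti hbd
    refine ⟨_, ((Complex.continuous_ofReal.tendsto _).comp this).congr ?_⟩
    intro i
    have := (Complex.le_def.1 (h0 i)).2
    apply Complex.ext <;> simp
    simpa using this
  choose c hc using hq
  have hent : ∀ a b, ∃ d : ℂ, Tendsto (fun i => r i a b) atTop (nhds d) := by
    intro a b
    set x : Fin n → ℂ := Pi.single a 1
    set y : Fin n → ℂ := Pi.single b 1
    refine ⟨_, (((((hc (x + y)).sub (hc (x - y))).sub ((hc (x + Complex.I • y)).const_mul Complex.I)).add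
      ((hc (x - Complex.I • y)).const_mul Complex.I)).const_mul (1 / 4)).sub_const (T a b) |>.congr ?_⟩
    intro i
    rw [← aux_polar]
    simp [x, y]
  choose R hR using hent
  refine ⟨Matrix.of R, ?_⟩
  exact tendsto_pi_nhds.2 fun a => tendsto_pi_nhds.2 fun b => hR a b

lemma aux_psd_lim (r : ℕ → Matrix (Fin n) (Fin n) ℂ) (R : Matrix (Fin n) (Fin n) ℂ)
    (h : ∀ i, (r i).PosSemidef) (hR : Tendsto r atTop (nhds R)) : R.PosSemidef := by
  refine .of_dotProduct_mulVec_nonneg ?_ ?_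
  · have h1 : Tendsto (fun i => (r i)ᴴ) atTop (nhds Rᴴ) :=
      ((continuous_id.matrix_conjTranspose).tendsto R).comp hR
    refine tendsto_nhds_unique h1 (hR.congr fun i => ((h i).1).symm)
  · intro v
    have h1 : Tendsto (fun i => star v ⬝ᵥ (r i *ᵥ v)) atTop (nhds (star v ⬝ᵥ (R *ᵥ v))) := by
      have : Continuous (fun M : Matrix (Fin n) (Fin n) ℂ => star v ⬝ᵥ (M *ᵥ v)) := by fun_prop
      exact (this.tendsto R).comp hR
    exact ge_of_tendsto' h1 fun i => (h i).dotProduct_mulVec_nonneg v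

lemma aux_inv_lim (r : ℕ → Matrix (Fin n) (Fin n) ℂ) (R : Matrix (Fin n) (Fin n) ℂ)
    (hu : IsUnit R) (hR : Tendsto r atTop (nhds R)) :
    Tendsto (fun i => (r i)⁻¹) atTop (nhds R⁻¹) := by
  have hd : R.det ≠ 0 := by
    simpa using (Matrix.isUnit_iff_isUnit_det _).1 hu
  have : ContinuousAt Inv.inv R := by
    apply continuousAt_matrix_inv
    simpa [Ring.inverse_eq_inv'] using continuousAt_inv₀ hd
  exact this.tendsto.comp hR

/-- right Riccati iterates -/
noncomputable def ricR (P L Q : ℕ → Matrix (Fin n) (Fin n) ℂ) :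
    ℕ → ℕ → Matrix (Fin n) (Fin n) ℂ
  | 0, k => P k
  | i + 1, k => P k - L k * (ricR P L Q i (k + 1) + Q k)⁻¹ * (L k)ᴴ

lemma aux_ric (P L Q T : ℕ → Matrix (Fin n) (Fin n) ℂ)
    (hP : ∀ k, (P k).IsHermitian)
    (hL : ∀ k, IsUnit (L k)) (hPT : ∀ k, (P k + T k).PosDef)
    (hT : ∀ k, T (k + 1) = Q k - (L k)ᴴ * (P k + T k)⁻¹ * L k) :
    ∃ R : ℕ → Matrix (Fin n) (Fin n) ℂ, (∀ k, (R k).IsHermitian) ∧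
      (∀ k, (R (k + 1) + Q k).PosDef) ∧
      (∀ k i, (ricR P L Q i (k + 1) + Q k).PosDef) ∧
      (∀ k, R k = P k - L k * (R (k + 1) + Q k)⁻¹ * (L k)ᴴ) ∧
      ∀ k, Tendsto (fun i => ricR P L Q i k) atTop (nhds (R k)) := by
  have hTH : ∀ k, (T k).IsHermitian := fun k => by
    have := (hPT k).1.sub (hP k)
    simpa using this
  have key : ∀ k (r : Matrix (Fin n) (Fin n) ℂ), (r + T (k + 1)).PosSemidef → (r + Q k).PosDef := by
    intro k r hr
    have h1 : ((L k)ᴴ * (P k + T k)⁻¹ * L k).PosDef :=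
      (hPT k).inv.conjTranspose_mul_mul_same (mulVec_injective_of_isUnit (hL k))
    have := h1.add_posSemidef hr
    rw [hT] at this
    convert this using 1
    abel
  have key2 : ∀ k (r : Matrix (Fin n) (Fin n) ℂ), (r + T (k + 1)).PosSemidef →
      (P k - L k * (r + Q k)⁻¹ * (L k)ᴴ + T k).PosSemidef := by
    intro k r hr
    have := (aux_schur (L k) (hPT k) (key k r hr)).1 (by
      rw [hT] at hr
      convert hr using 1
      abel)
    convert this using 1
    abel
  have h1 : ∀ i k, (ricR P L Q i k + T k).PosSemidef := by
    intro i
    induction i with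
    | zero => intro k; exact (hPT k).posSemidef
    | succ i ih => intro k; exact key2 k _ (ih (k + 1))
  have h2 : ∀ i k, (ricR P L Q i k - ricR P L Q (i + 1) k).PosSemidef := by
    intro i
    induction i with
    | zero =>
      intro k
      have := (key k _ (h1 0 (k + 1))).inv.posSemidef.mul_mul_conjTranspose_same (L k)
      simpa [ricR] using this
    | succ i ih =>
      intro k
      have h3 := key k _ (h1 (i + 1) (k + 1))
      have h4 := (aux_inv_anti h3 (V := ricR P L Q i (k + 1) + Q k) (by
        simpa using ih (k + 1))).mul_mul_conjTranspose_same (L k)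
      rw [ricR, ricR]
      convert h4 using 1
      simp only [Matrix.mul_sub, Matrix.sub_mul]
      abel
  have h3 : ∀ k, ∃ R, Tendsto (fun i => ricR P L Q i k) atTop (nhds R) := fun k =>
    aux_conv _ (T k) (fun i => h2 i k) (fun i => h1 i k)
  choose R hR using h3
  have h4 : ∀ k, (R k + T k).PosSemidef := fun k =>
    aux_psd_lim _ _ (fun i => h1 i k) ((hR k).add_const _)
  refine ⟨R, fun k => ?_, fun k => key k _ (h4 (k + 1)), fun k i => key k _ (h1 i (k + 1)), ?_, hR⟩
  · have := (h4 k).1.sub (hTH k)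
    simpa using this
  · intro k
    have h5 := aux_inv_lim _ _ (key k _ (h4 (k + 1))).isUnit ((hR (k + 1)).add_const (Q k))
    have h6 : Tendsto (fun i => ricR P L Q (i + 1) k) atTop (nhds (R k)) :=
      (hR k).comp (tendsto_add_atTop_nat 1)
    refine tendsto_nhds_unique h6 ?_
    simp only [ricR]
    exact ((h5.const_mul (L k)).mul_const _).const_sub _

lemma aux_step (L Li Lh Lhi V Vi Z Zi E K : Matrix (Fin n) (Fin n) ℂ)
    (h1 : Li * L = 1) (h2 : L * Li = 1) (h3 : Lh * Lhi = 1) (h5 : Vi * V = 1)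
    (h6 : Zi * Z = 1) (hZ : Z = V + E) (hE : E * K = 1) :
    (L * Vi * Lh - L * Zi * Lh) *
      (Lhi * V * Li + (Lhi * V * Li) * L * K * Lh * (Lhi * V * Li)) = 1 := by
  have e1 : Lhi * V * Li + (Lhi * V * Li) * L * K * Lh * (Lhi * V * Li)
      = Lhi * (V + V * K * V) * Li := by
    calc _ = Lhi * V * Li + Lhi * V * (Li * L) * K * (Lh * Lhi) * V * Li := by noncomm_ring
      _ = _ := by rw [h1, h3]; noncomm_ring
  have e2 : V + V * K * V = Z * K * V := by
    calc V + V * K * V = (E * K) * V + V * K * V := by rw [hE]; simp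
      _ = _ := by rw [hZ]; noncomm_ring
  calc _ = L * (Vi - Zi) * (Lh * Lhi) * (V + V * K * V) * Li := by rw [e1]; noncomm_ring
    _ = L * ((Vi * V) * (1 + K * V) - Zi * (V + V * K * V)) * Li := by rw [h3]; noncomm_ring
    _ = L * ((Vi * V) * (1 + K * V) - (Zi * Z) * K * V) * Li := by rw [e2]; noncomm_ring
    _ = L * Li := by rw [h5, h6]; noncomm_ring
    _ = 1 := h2

lemma aux_mi {A : Matrix (Fin n) (Fin n) ℂ} (h : IsUnit A) : A * A⁻¹ = 1 :=
  Matrix.mul_nonsing_inv _ ((Matrix.isUnit_iff_isUnit_det _).1 h)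

lemma aux_im {A : Matrix (Fin n) (Fin n) ℂ} (h : IsUnit A) : A⁻¹ * A = 1 :=
  Matrix.nonsing_inv_mul _ ((Matrix.isUnit_iff_isUnit_det _).1 h)

lemma aux_uh {A : Matrix (Fin n) (Fin n) ℂ} (h : IsUnit A) : IsUnit Aᴴ :=
  (Matrix.isUnit_conjTranspose _).2 h

noncomputable def Gm (P R X : ℕ → Matrix (Fin n) (Fin n) ℂ) (j : ℕ) : Matrix (Fin n) (Fin n) ℂ :=
  (X j)⁻¹ * (P j - R j)⁻¹ * ((X j)ᴴ)⁻¹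

lemma aux_H (P L Q R X : ℕ → Matrix (Fin n) (Fin n) ℂ)
    (hL : ∀ k, IsUnit (L k)) (hRQ : ∀ k, (R (k + 1) + Q k).PosDef)
    (hrQ : ∀ k i, (ricR P L Q i (k + 1) + Q k).PosDef)
    (hR : ∀ k, R k = P k - L k * (R (k + 1) + Q k)⁻¹ * (L k)ᴴ)
    (hXu : ∀ k, IsUnit (X k)) (hX : ∀ k, L k * X (k + 1) = (P k - R k) * X k) :
    ∀ i k, (ricR P L Q i k - R k) *
      (X k * (∑ j ∈ Finset.range (i + 1), Gm P R X (k + j)) * (X k)ᴴ) = 1 := by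
  have hN : ∀ k, P k - R k = L k * (R (k + 1) + Q k)⁻¹ * (L k)ᴴ := fun k => by
    conv_lhs => rw [hR k]
    abel
  have hNi : ∀ k, (P k - R k)⁻¹ = ((L k)ᴴ)⁻¹ * (R (k + 1) + Q k) * (L k)⁻¹ := fun k => by
    rw [hN, Matrix.mul_inv_rev, Matrix.mul_inv_rev, Matrix.nonsing_inv_nonsing_inv _
      ((Matrix.isUnit_iff_isUnit_det _).1 (hRQ k).isUnit), Matrix.mul_assoc]
  have hNu : ∀ k, IsUnit (P k - R k) := fun k => by
    rw [hN]
    exact ((hL k).mul (hRQ k).inv.isUnit).mul (aux_uh (hL k))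
  have hGk : ∀ k, X k * Gm P R X k * (X k)ᴴ = (P k - R k)⁻¹ := fun k => by
    rw [Gm]
    calc _ = (X k * (X k)⁻¹) * (P k - R k)⁻¹ * (((X k)ᴴ)⁻¹ * (X k)ᴴ) := by noncomm_ring
      _ = _ := by rw [aux_mi (hXu k), aux_im (aux_uh (hXu k))]; simp
  intro i
  induction i with
  | zero =>
    intro k
    simp only [ricR, zero_add, Finset.range_one, Finset.sum_singleton, add_zero]
    rw [hGk, aux_mi (hNu k)]
  | succ i ih =>
    intro k
    have hXk : X k = (P k - R k)⁻¹ * L k * X (k + 1) := by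
      rw [Matrix.mul_assoc, hX, ← Matrix.mul_assoc, aux_im (hNu k), Matrix.one_mul]
    have hNh : ((P k - R k)⁻¹)ᴴ = (P k - R k)⁻¹ := by
      have : (P k - R k).PosDef := by
        rw [hN]
        exact (hRQ k).inv.mul_mul_conjTranspose_same
          (Matrix.vecMul_injective_of_isUnit (hL k))
      exact this.inv.1
    rw [Finset.sum_range_succ', add_zero]
    set H := ∑ j ∈ Finset.range (i + 1), Gm P R X (k + (j + 1)) with hH
    have hH' : H = ∑ j ∈ Finset.range (i + 1), Gm P R X (k + 1 + j) := by
      rw [hH]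
      refine Finset.sum_congr rfl fun j _ => ?_
      congr 1
      omega
    have h1 := ih (k + 1)
    rw [← hH'] at h1
    have e1 : X k * (H + Gm P R X k) * (X k)ᴴ = (P k - R k)⁻¹ + (P k - R k)⁻¹ * L k *
        (X (k + 1) * H * (X (k + 1))ᴴ) * (L k)ᴴ * (P k - R k)⁻¹ := by
      have e2 : X k * H * (X k)ᴴ = (P k - R k)⁻¹ * L k *
        (X (k + 1) * H * (X (k + 1))ᴴ) * (L k)ᴴ * (P k - R k)⁻¹ := by
        conv_lhs => rw [hXk]
        simp only [Matrix.conjTranspose_mul, hNh, Matrix.mul_assoc]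
      rw [Matrix.mul_add, Matrix.add_mul, hGk, e2, add_comm]
    rw [e1, hNi]
    have e3 : ricR P L Q (i + 1) k - R k = L k * (R (k + 1) + Q k)⁻¹ * (L k)ᴴ
        - L k * (ricR P L Q i (k + 1) + Q k)⁻¹ * (L k)ᴴ := by
      rw [← hN, ricR]
      abel
    rw [e3]
    exact aux_step (L k) (L k)⁻¹ (L k)ᴴ ((L k)ᴴ)⁻¹ (R (k + 1) + Q k) _
      (ricR P L Q i (k + 1) + Q k) _ _ _ (aux_im (hL k)) (aux_mi (hL k)) (aux_mi (aux_uh (hL k)))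
      (aux_im (hRQ k).isUnit) (aux_im (hrQ k i).isUnit) (by abel) h1

lemma aux_Y (E H Y : ℕ → Matrix (Fin n) (Fin n) ℂ) (Y0 : Matrix (Fin n) (Fin n) ℂ)
    (hE : Tendsto E atTop (nhds 0)) (hEH : ∀ i, E i * H i = 1) (hY : ∀ i, Y i = Y0 - H i) :
    (∃ i₀, ∀ i, i₀ ≤ i → IsUnit (Y i)) ∧ Tendsto (fun i => (Y i)⁻¹) atTop (nhds 0) := by
  have h1 : ∀ i, E i * Y i = E i * Y0 - 1 := fun i => by rw [hY, Matrix.mul_sub, hEH]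
  have h2 : Tendsto (fun i => E i * Y i) atTop (nhds (-1)) := by
    simp only [h1]
    have := (hE.mul_const Y0).sub_const 1
    simpa using this
  have hEu : ∀ i, IsUnit (E i) := fun i =>
    (Matrix.isUnit_iff_isUnit_det _).2 (Matrix.isUnit_det_of_right_inverse (hEH i))
  have h3 : ∀ᶠ i in atTop, IsUnit (Y i) := by
    have hd : Tendsto (fun i => (E i * Y i).det) atTop (nhds (-1 : Matrix (Fin n) (Fin n) ℂ).det) :=
      ((continuous_id.matrix_det).tendsto _).comp h2
    have hne : (-1 : Matrix (Fin n) (Fin n) ℂ).det ≠ 0 := by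
      simp [Matrix.det_neg]
    filter_upwards [hd.eventually_ne hne] with i hi
    rw [Matrix.isUnit_iff_isUnit_det, isUnit_iff_ne_zero]
    rw [Matrix.det_mul] at hi
    exact right_ne_zero_of_mul hi
  refine ⟨eventually_atTop.1 h3, ?_⟩
  have h4 := aux_inv_lim _ _ (isUnit_one.neg) h2
  have h5 := h4.mul hE
  rw [mul_zero] at h5
  refine h5.congr fun i => ?_
  rw [Matrix.mul_inv_rev, Matrix.mul_assoc, aux_im (hEu i), Matrix.mul_one]

/-- left Riccati solution -/
noncomputable def ricT (P L Q : ℕ → Matrix (Fin n) (Fin n) ℂ) :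
    ℕ → Matrix (Fin n) (Fin n) ℂ
  | 0 => Q 0
  | k + 1 => Q (k + 1) - (L (k + 1))ᴴ * (P (k + 1) + ricT P L Q k)⁻¹ * L (k + 1)

noncomputable def termF (P L Q : Matrix (Fin n) (Fin n) ℂ) (a b : Fin n → ℂ) : ℂ :=
  star a ⬝ᵥ (P *ᵥ a) - star a ⬝ᵥ (L *ᵥ b) - star b ⬝ᵥ (Lᴴ *ᵥ a) + star b ⬝ᵥ (Q *ᵥ b)

lemma aux_T (P L Q : ℕ → Matrix (Fin n) (Fin n) ℂ)
    (hP : ∀ k, (P k).IsHermitian) (hQ : ∀ k, (Q k).IsHermitian)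
    (hpos : ∀ (m : ℕ) (x : ℕ → Fin n → ℂ), x 0 = 0 → x (m + 1) = 0 → x m ≠ 0 →
      0 < ∑ i ∈ Finset.range (m + 1), termF (P i) (L i) (Q i) (x i) (x (i + 1))) :
    ∀ k, (P (k + 1) + ricT P L Q k).PosDef := by
  have hpd : ∀ k, (ricT P L Q k).IsHermitian → (∀ ξ : Fin n → ℂ, ∃ x : ℕ → Fin n → ℂ, x 0 = 0 ∧
      x (k + 1) = ξ ∧ ∑ i ∈ Finset.range (k + 1), termF (P i) (L i) (Q i) (x i) (x (i + 1))
        = star ξ ⬝ᵥ (ricT P L Q k *ᵥ ξ)) → (P (k + 1) + ricT P L Q k).PosDef := by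
    intro k hH hx
    refine .of_dotProduct_mulVec_pos ((hP _).add hH) fun ξ hξ => ?_
    obtain ⟨x, hx0, hxk, hs⟩ := hx ξ
    have h := hpos (k + 1) (Function.update x (k + 2) 0)
      (by rw [Function.update_of_ne (by omega)]; exact hx0) (by simp)
      (by rw [Function.update_of_ne (by omega), hxk]; exact hξ)
    rw [Finset.sum_range_succ] at h
    have e : ∑ i ∈ Finset.range (k + 1), termF (P i) (L i) (Q i)
        (Function.update x (k + 2) 0 i) (Function.update x (k + 2) 0 (i + 1))
        = star ξ ⬝ᵥ (ricT P L Q k *ᵥ ξ) := by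
      rw [← hs]
      refine Finset.sum_congr rfl fun i hi => ?_
      have := Finset.mem_range.1 hi
      rw [Function.update_of_ne (by omega), Function.update_of_ne (by omega)]
    rw [e, Function.update_of_ne (by omega), Function.update_self, hxk] at h
    simp only [termF, mulVec_zero, dotProduct_zero, star_zero, zero_dotProduct, sub_zero,
      add_zero] at h
    rw [add_mulVec, dotProduct_add, add_comm]
    exact h
  have hcl : ∀ k, (ricT P L Q k).IsHermitian ∧ ∀ ξ : Fin n → ℂ, ∃ x : ℕ → Fin n → ℂ, x 0 = 0 ∧
      x (k + 1) = ξ ∧ ∑ i ∈ Finset.range (k + 1), termF (P i) (L i) (Q i) (x i) (x (i + 1))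
        = star ξ ⬝ᵥ (ricT P L Q k *ᵥ ξ) := by
    intro k
    induction k with
    | zero =>
      refine ⟨hQ 0, fun ξ => ⟨fun i => if i = 1 then ξ else 0, by simp, by simp, ?_⟩⟩
      simp [termF, ricT]
    | succ k ih =>
      have hK := hpd k ih.1 ih.2
      refine ⟨?_, fun ξ => ?_⟩
      · have h := hK.inv.posSemidef.conjTranspose_mul_mul_same (L (k + 1))
        exact (hQ _).sub h.1
      · set a := (P (k + 1) + ricT P L Q k)⁻¹ *ᵥ (L (k + 1) *ᵥ ξ) with ha
        obtain ⟨x, hx0, hxk, hs⟩ := ih.2 a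
        refine ⟨Function.update x (k + 2) ξ, by rw [Function.update_of_ne (by omega)]; exact hx0,
          by simp, ?_⟩
        rw [Finset.sum_range_succ]
        have e : ∑ i ∈ Finset.range (k + 1), termF (P i) (L i) (Q i)
            (Function.update x (k + 2) ξ i) (Function.update x (k + 2) ξ (i + 1))
            = star a ⬝ᵥ (ricT P L Q k *ᵥ a) := by
          rw [← hs]
          refine Finset.sum_congr rfl fun i hi => ?_
          have := Finset.mem_range.1 hi
          rw [Function.update_of_ne (by omega), Function.update_of_ne (by omega)]
        rw [e, Function.update_of_ne (by omega), Function.update_self, hxk]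
        have e2 : (P (k + 1) + ricT P L Q k) *ᵥ a = L (k + 1) *ᵥ ξ := by
          rw [ha, mulVec_mulVec, aux_mi hK.isUnit, one_mulVec]
        have e3 : star a ⬝ᵥ (P (k + 1) *ᵥ a) + star a ⬝ᵥ (ricT P L Q k *ᵥ a)
            = star a ⬝ᵥ (L (k + 1) *ᵥ ξ) := by
          rw [← e2, add_mulVec, dotProduct_add]
        have e4 : star ξ ⬝ᵥ (ricT P L Q (k + 1) *ᵥ ξ)
            = star ξ ⬝ᵥ (Q (k + 1) *ᵥ ξ) - star ξ ⬝ᵥ ((L (k + 1))ᴴ *ᵥ a) := by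
          rw [ricT, sub_mulVec, dotProduct_sub, ha]
          simp only [mulVec_mulVec, Matrix.mul_assoc]
        rw [e4, termF]
        linear_combination e3
  exact fun k => hpd k (hcl k).1 (hcl k).2


/-- One step in Jacobi form. -/
structure JStep (A B C D P L Q : Matrix (Fin n) (Fin n) ℂ) : Prop where
  hP : P.IsHermitian
  hQ : Q.IsHermitian
  hL : IsUnit L
  hB : B = -(Lᴴ)⁻¹
  hBL : B * Lᴴ = -1
  hLB : Lᴴ * B = -1
  hBQ : B * Q = -A
  hLA : Lᴴ * A = Q
  hDL : D * Lᴴ = P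
  hCD : C + D * Q = L

lemma aux_jstep (A B C D : Matrix (Fin n) (Fin n) ℂ) (hBu : IsUnit B)
    (h1 : Aᴴ * C = Cᴴ * A) (h2 : Bᴴ * D = Dᴴ * B) (h3 : Aᴴ * D - Cᴴ * B = 1) :
    JStep A B C D (-(D * B⁻¹)) (-(Bᴴ)⁻¹) (-(B⁻¹ * A)) := by
  have hBhu := aux_uh hBu
  have hLh : (-(Bᴴ)⁻¹ : Matrix (Fin n) (Fin n) ℂ)ᴴ = -B⁻¹ := by
    rw [conjTranspose_neg, conjTranspose_nonsing_inv, conjTranspose_conjTranspose]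
  have k1 : (Bᴴ)⁻¹ * Dᴴ = D * B⁻¹ := by
    calc (Bᴴ)⁻¹ * Dᴴ = (Bᴴ)⁻¹ * Dᴴ * (B * B⁻¹) := by rw [aux_mi hBu, Matrix.mul_one]
      _ = (Bᴴ)⁻¹ * (Dᴴ * B) * B⁻¹ := by noncomm_ring
      _ = ((Bᴴ)⁻¹ * Bᴴ) * D * B⁻¹ := by rw [← h2]; noncomm_ring
      _ = _ := by rw [aux_im hBhu, Matrix.one_mul]
  have k2 : Cᴴ = Aᴴ * (D * B⁻¹) - B⁻¹ := by
    calc Cᴴ = Cᴴ * (B * B⁻¹) := by rw [aux_mi hBu, Matrix.mul_one]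
      _ = (Aᴴ * D - (Aᴴ * D - Cᴴ * B)) * B⁻¹ := by noncomm_ring
      _ = _ := by rw [h3]; noncomm_ring
  have kP : (D * B⁻¹)ᴴ = D * B⁻¹ := by
    rw [conjTranspose_mul, conjTranspose_nonsing_inv, k1]
  have k3 : C = D * (B⁻¹ * A) - (Bᴴ)⁻¹ := by
    have := congrArg conjTranspose k2
    rw [conjTranspose_conjTranspose, conjTranspose_sub, conjTranspose_mul, kP,
      conjTranspose_conjTranspose, conjTranspose_nonsing_inv, Matrix.mul_assoc] at this
    exact this
  have kQ : (B⁻¹ * A)ᴴ = B⁻¹ * A := by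
    have e1 : Cᴴ * A = Aᴴ * (D * B⁻¹) * A - B⁻¹ * A := by
      rw [k2]; noncomm_ring
    have e2 : Aᴴ * C = Aᴴ * (D * B⁻¹) * A - Aᴴ * (Bᴴ)⁻¹ := by
      rw [k3]; noncomm_ring
    rw [conjTranspose_mul, conjTranspose_nonsing_inv]
    rw [e1, e2] at h1
    exact sub_right_injective h1
  have hnn : ((-B⁻¹ : Matrix (Fin n) (Fin n) ℂ))⁻¹ = -B := by
    apply Matrix.inv_eq_right_inv
    rw [neg_mul_neg, aux_im hBu]
  refine ⟨?_, ?_, ?_, ?_, ?_, ?_, ?_, ?_, ?_, ?_⟩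
  · rw [Matrix.IsHermitian, conjTranspose_neg, kP]
  · rw [Matrix.IsHermitian, conjTranspose_neg, kQ]
  · exact ((Matrix.isUnit_nonsing_inv_iff).2 hBhu).neg
  · rw [hLh, hnn, neg_neg]
  · rw [hLh, mul_neg, aux_mi hBu]
  · rw [hLh, neg_mul, aux_im hBu]
  · rw [mul_neg, ← Matrix.mul_assoc, aux_mi hBu, Matrix.one_mul]
  · rw [hLh, neg_mul]
  · rw [hLh, mul_neg]
  · rw [k3]; noncomm_ring

/-- the summand of the quadratic functional in Jacobi form -/
lemma aux_term {A B C D P L Q : Matrix (Fin n) (Fin n) ℂ} (h : JStep A B C D P L Q)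
    (a b u : Fin n → ℂ) (ha : a = A *ᵥ b + B *ᵥ u) (h3 : Aᴴ * D - Cᴴ * B = 1) :
    star b ⬝ᵥ ((Cᴴ * A) *ᵥ b) + 2 * ((star b ⬝ᵥ ((Cᴴ * B) *ᵥ u)).re : ℂ)
      + star u ⬝ᵥ ((Dᴴ * B) *ᵥ u) = -termF P L Q a b := by
  have hu : u = -(Lᴴ *ᵥ a) + Q *ᵥ b := by
    rw [ha, mulVec_add, mulVec_mulVec, mulVec_mulVec, h.hLA, h.hLB, neg_mulVec, one_mulVec]
    abel
  have hw : C *ᵥ b + D *ᵥ u = -(P *ᵥ a) + L *ᵥ b := by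
    rw [hu, mulVec_add, mulVec_neg, mulVec_mulVec, mulVec_mulVec, h.hDL, ← h.hCD, add_mulVec]
    abel
  have hst : ∀ (M : Matrix (Fin n) (Fin n) ℂ) (x y : Fin n → ℂ),
      star (M *ᵥ x) ⬝ᵥ y = star x ⬝ᵥ (Mᴴ *ᵥ y) := fun M x y => by
    rw [star_mulVec, dotProduct_mulVec]
  have hre : 2 * ((star b ⬝ᵥ ((Cᴴ * B) *ᵥ u)).re : ℂ)
      = star b ⬝ᵥ ((Cᴴ * B) *ᵥ u) + star u ⬝ᵥ ((Bᴴ * C) *ᵥ b) := by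
    have : star (star b ⬝ᵥ ((Cᴴ * B) *ᵥ u)) = star u ⬝ᵥ ((Bᴴ * C) *ᵥ b) := by
      rw [← star_dotProduct_star, star_star, hst]
      simp [dotProduct_comm]
    rw [← this, Complex.star_def, Complex.add_conj]
    push_cast; ring
  have e4 : Bᴴ * C = Dᴴ * A - 1 := by
    have := congrArg conjTranspose h3
    simp only [conjTranspose_sub, conjTranspose_mul, conjTranspose_conjTranspose,
      conjTranspose_one] at this
    rw [← this]; abel
  have e5 : star (C *ᵥ b + D *ᵥ u) ⬝ᵥ a - star u ⬝ᵥ b =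
      star b ⬝ᵥ ((Cᴴ * A) *ᵥ b) + 2 * ((star b ⬝ᵥ ((Cᴴ * B) *ᵥ u)).re : ℂ)
      + star u ⬝ᵥ ((Dᴴ * B) *ᵥ u) := by
    rw [hre, e4, ha, star_add, add_dotProduct, hst, hst]
    simp only [mulVec_add, dotProduct_add, mulVec_mulVec, sub_mulVec, one_mulVec, dotProduct_sub]
    ring
  rw [← e5, hw, hu, termF]
  simp only [star_add, star_neg, add_dotProduct, neg_dotProduct, hst, h.hP.eq, h.hQ.eq,
    conjTranspose_conjTranspose]
  ring

/-- solution step equivalence -/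
lemma aux_sol {A B C D P L Q : Matrix (Fin n) (Fin n) ℂ} (h : JStep A B C D P L Q)
    (X U X' U' : Matrix (Fin n) (Fin n) ℂ) :
    (X = A * X' + B * U' ∧ U = C * X' + D * U') ↔
      (U = -(P * X) + L * X' ∧ U' = -(Lᴴ * X) + Q * X') := by
  constructor
  · rintro ⟨h1, h2⟩
    have hu : U' = -(Lᴴ * X) + Q * X' := by
      rw [h1, Matrix.mul_add, ← Matrix.mul_assoc, ← Matrix.mul_assoc, h.hLA, h.hLB]
      noncomm_ring
    refine ⟨?_, hu⟩
    rw [h2, hu, ← h.hDL, ← h.hCD]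
    noncomm_ring
  · rintro ⟨h1, h2⟩
    constructor
    · rw [h2]
      calc X = A * X' + (-(B * Lᴴ)) * X + B * Q * X' := by rw [h.hBL, h.hBQ]; noncomm_ring
        _ = _ := by noncomm_ring
    · rw [h1, h2, ← h.hDL, ← h.hCD]; noncomm_ring

lemma aux_extend (S : ℕ → Matrix (Fin n ⊕ Fin n) (Fin n ⊕ Fin n) ℂ) (K : ℕ) :
    ∀ z : ℕ → Matrix (Fin n ⊕ Fin n) (Fin n) ℂ, (∀ i, z i = S (K + i) * z (i + 1)) →
      ∃ Z : ℕ → Matrix (Fin n ⊕ Fin n) (Fin n) ℂ, (∀ k, Z k = S k * Z (k + 1)) ∧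
        ∀ i, Z (K + i) = z i := by
  induction K with
  | zero => intro z hz; exact ⟨z, fun k => by simpa using hz k, fun i => by simp⟩
  | succ K ih =>
    intro z hz
    obtain ⟨Z, h1, h2⟩ := ih (fun i => Nat.casesOn i (S K * z 0) z) (by
      intro i
      cases i with
      | zero => rfl
      | succ i =>
        have := hz i
        rw [show K + 1 + i = K + (i + 1) by omega] at this
        exact this)
    refine ⟨Z, h1, fun i => ?_⟩
    have := h2 (i + 1)
    rw [show K + 1 + i = K + (i + 1) by omega]
    exact this

lemma aux_const {α : Type*} (f : ℕ → α) (h : ∀ k, f k = f (k + 1)) (k K : ℕ) : f k = f K := by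
  have : ∀ k, f k = f 0 := fun k => by
    induction k with
    | zero => rfl
    | succ k ih => rw [← h, ih]
  rw [this k, this K]

/-- the recessive solution in Jacobi form -/
lemma aux_core (P L Q : ℕ → Matrix (Fin n) (Fin n) ℂ)
    (hP : ∀ k, (P k).IsHermitian) (hQ : ∀ k, (Q k).IsHermitian) (hL : ∀ k, IsUnit (L k))
    (hpos : ∀ (m : ℕ) (x : ℕ → Fin n → ℂ), x 0 = 0 → x (m + 1) = 0 → x m ≠ 0 →
      0 < ∑ i ∈ Finset.range (m + 1), termF (P i) (L i) (Q i) (x i) (x (i + 1))) :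
    ∃ R X : ℕ → Matrix (Fin n) (Fin n) ℂ, (∀ k, (R k).IsHermitian) ∧ (∀ k, IsUnit (X k)) ∧
      X 0 = 1 ∧
      (∀ k, (P (k + 1) - R k).PosDef) ∧
      (∀ k, L (k + 1) * X (k + 1) = (P (k + 1) - R k) * X k) ∧
      (∀ k, (R (k + 1) + Q (k + 1)) * X (k + 1) = (L (k + 1))ᴴ * X k) ∧
      ∀ Y : ℕ → Matrix (Fin n) (Fin n) ℂ,
        (∀ k, Y (k + 1) = Y k - (X k)⁻¹ * (P (k + 1) - R k)⁻¹ * ((X k)ᴴ)⁻¹) →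
        (∃ i₀, ∀ i, i₀ ≤ i → IsUnit (Y i)) ∧ Tendsto (fun i => (Y i)⁻¹) atTop (nhds 0) := by
  have hT := aux_T P L Q hP hQ hpos
  obtain ⟨R, hRH, hRQ, hrQ, hR, hlim⟩ := aux_ric (fun k => P (k + 1)) (fun k => L (k + 1))
    (fun k => Q (k + 1)) (ricT P L Q) (fun k => hP _) (fun k => hL _) hT (fun k => rfl)
  have hN : ∀ k, P (k + 1) - R k
      = L (k + 1) * (R (k + 1) + Q (k + 1))⁻¹ * (L (k + 1))ᴴ := fun k => by
    conv_lhs => rw [hR k]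
    abel
  have hNp : ∀ k, (P (k + 1) - R k).PosDef := fun k => by
    rw [hN]
    exact (hRQ k).inv.mul_mul_conjTranspose_same (Matrix.vecMul_injective_of_isUnit (hL _))
  let X : ℕ → Matrix (Fin n) (Fin n) ℂ := fun k =>
    Nat.rec 1 (fun k Xk => (L (k + 1))⁻¹ * (P (k + 1) - R k) * Xk) k
  have hXs : ∀ k, X (k + 1) = (L (k + 1))⁻¹ * (P (k + 1) - R k) * X k := fun k => rfl
  have hXu : ∀ k, IsUnit (X k) := by
    intro k
    induction k with
    | zero => exact isUnit_one
    | succ k ih =>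
      rw [hXs]
      exact (((Matrix.isUnit_nonsing_inv_iff).2 (hL _)).mul (hNp k).isUnit).mul ih
  have hLX : ∀ k, L (k + 1) * X (k + 1) = (P (k + 1) - R k) * X k := fun k => by
    rw [hXs, ← Matrix.mul_assoc, ← Matrix.mul_assoc, aux_mi (hL _), Matrix.one_mul]
  refine ⟨R, X, hRH, hXu, rfl, hNp, hLX, ?_, ?_⟩
  · intro k
    rw [hXs, hN]
    calc _ = (R (k + 1) + Q (k + 1)) * ((L (k + 1))⁻¹ * L (k + 1)) *
          (R (k + 1) + Q (k + 1))⁻¹ * (L (k + 1))ᴴ * X k := by noncomm_ring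
      _ = _ := by rw [aux_im (hL _), Matrix.mul_one, aux_mi (hRQ k).isUnit, Matrix.one_mul]
  · intro Y hY
    have hH := aux_H (fun k => P (k + 1)) (fun k => L (k + 1)) (fun k => Q (k + 1)) R X
      (fun k => hL _) hRQ hrQ hR hXu hLX
    have hYs : ∀ i, Y i = Y 0 - ∑ j ∈ Finset.range i, Gm (fun k => P (k + 1)) R X j := by
      intro i
      induction i with
      | zero => simp
      | succ i ih => rw [hY, Finset.sum_range_succ, ih, Gm]; abel
    obtain ⟨⟨i₀, h1⟩, h2⟩ := aux_Y
      (fun i => ricR (fun k => P (k + 1)) (fun k => L (k + 1)) (fun k => Q (k + 1)) i 0 - R 0)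
      (fun i => ∑ j ∈ Finset.range (i + 1), Gm (fun k => P (k + 1)) R X j)
      (fun i => Y (i + 1)) (Y 0)
      (by have := (hlim 0).sub_const (R 0); simpa using this)
      (fun i => by
        have := hH i 0
        have hX0 : X 0 = 1 := rfl
        simpa [hX0] using this)
      (fun i => hYs (i + 1))
    refine ⟨⟨i₀ + 1, fun i hi => ?_⟩, (tendsto_add_atTop_iff_nat 1).1 h2⟩
    have := h1 (i - 1) (by omega)
    rwa [show i - 1 + 1 = i by omega] at this


lemma aux_sympl (A B C D : Matrix (Fin n) (Fin n) ℂ) :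
    (Matrix.fromBlocks A B C D)ᴴ * Jmat n * Matrix.fromBlocks A B C D = Jmat n ↔
      (Aᴴ * C = Cᴴ * A ∧ Bᴴ * D = Dᴴ * B ∧ Aᴴ * D - Cᴴ * B = 1) := by
  rw [Jmat, fromBlocks_conjTranspose, fromBlocks_multiply, fromBlocks_multiply, fromBlocks_inj]
  simp only [Matrix.mul_zero, Matrix.mul_one, Matrix.mul_neg, zero_add, add_zero, Matrix.neg_mul]
  constructor
  · rintro ⟨h1, h2, h3, h4⟩
    refine ⟨?_, ?_, ?_⟩
    · rw [← sub_eq_zero, ← h1]; abel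
    · rw [← sub_eq_zero, ← h4]; abel
    · rw [← h2]; abel
  · rintro ⟨h1, h2, h3⟩
    have h4 := congrArg conjTranspose h3
    simp only [conjTranspose_sub, conjTranspose_mul, conjTranspose_conjTranspose,
      conjTranspose_one] at h4
    refine ⟨?_, ?_, ?_, ?_⟩
    · rw [h1]; abel
    · rw [← h3]; abel
    · rw [← h4]; abel
    · rw [h2]; abel

lemma aux_shift (A B C D W : Matrix (Fin n) (Fin n) ℂ) (hW : W.IsHermitian) (l : ℝ)
    (b u : Fin n → ℂ) :
    star b ⬝ᵥ (((C + (l : ℂ) • (W * A))ᴴ * A) *ᵥ b)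
        + 2 * ((star b ⬝ᵥ (((C + (l : ℂ) • (W * A))ᴴ * B) *ᵥ u)).re : ℂ)
        + star u ⬝ᵥ (((D + (l : ℂ) • (W * B))ᴴ * B) *ᵥ u)
    = star b ⬝ᵥ ((Cᴴ * A) *ᵥ b) + 2 * ((star b ⬝ᵥ ((Cᴴ * B) *ᵥ u)).re : ℂ)
      + star u ⬝ᵥ ((Dᴴ * B) *ᵥ u)
      + (l : ℂ) * (star (A *ᵥ b + B *ᵥ u) ⬝ᵥ (W *ᵥ (A *ᵥ b + B *ᵥ u))) := by
  have hst : ∀ (M : Matrix (Fin n) (Fin n) ℂ) (x y : Fin n → ℂ),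
      star (M *ᵥ x) ⬝ᵥ y = star x ⬝ᵥ (Mᴴ *ᵥ y) := fun M x y => by
    rw [star_mulVec, dotProduct_mulVec]
  have hre : 2 * ((star b ⬝ᵥ ((Aᴴ * W * B) *ᵥ u)).re : ℂ)
      = star b ⬝ᵥ ((Aᴴ * W * B) *ᵥ u) + star u ⬝ᵥ ((Bᴴ * W * A) *ᵥ b) := by
    have : star (star b ⬝ᵥ ((Aᴴ * W * B) *ᵥ u)) = star u ⬝ᵥ ((Bᴴ * W * A) *ᵥ b) := by
      rw [← star_dotProduct_star, star_star, hst]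
      simp [dotProduct_comm, Matrix.mul_assoc, hW.eq]
    rw [← this, Complex.star_def, Complex.add_conj]
    push_cast; ring
  have hc : ∀ (X Y : Matrix (Fin n) (Fin n) ℂ) (Z : Matrix (Fin n) (Fin n) ℂ),
      (X + (l : ℂ) • (W * Y))ᴴ * Z = Xᴴ * Z + (l : ℂ) • (Yᴴ * W * Z) := fun X Y Z => by
    rw [conjTranspose_add, conjTranspose_smul, conjTranspose_mul, hW.eq, Matrix.add_mul,
      Matrix.smul_mul]
    simp
  rw [hc, hc, hc]
  simp only [star_add, add_dotProduct, hst, add_mulVec, dotProduct_add, smul_mulVec,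
    dotProduct_smul, smul_eq_mul, mulVec_add, mulVec_mulVec, Complex.add_re,
    Complex.re_ofReal_mul, ← Matrix.mul_assoc]
  push_cast
  linear_combination (l : ℂ) * hre

lemma aux_Fshift (A B C D W : ℕ → Matrix (Fin n) (Fin n) ℂ) (hW : ∀ k, (W k).PosDef)
    (l nu : ℝ) (x u : ℕ → Fin n → ℂ) (N : ℕ)
    (hx : ∀ k, k ≤ N → x k = A k *ᵥ x (k + 1) + B k *ᵥ u (k + 1)) :
    Fquad A B C D W l x u 0 N = Fquad A B C D W nu x u 0 N
      + ((nu - l : ℝ) : ℂ) * ∑ k ∈ Finset.Icc 0 N, star (x k) ⬝ᵥ (W k *ᵥ x k) := by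
  have h : ∀ l' : ℝ, Fquad A B C D W l' x u 0 N = -∑ k ∈ Finset.Icc 0 N,
      (star (x (k + 1)) ⬝ᵥ (((C k)ᴴ * A k) *ᵥ x (k + 1))
        + 2 * ((star (x (k + 1)) ⬝ᵥ (((C k)ᴴ * B k) *ᵥ u (k + 1))).re : ℂ)
      + star (u (k + 1)) ⬝ᵥ (((D k)ᴴ * B k) *ᵥ u (k + 1)))
      - (l' : ℂ) * ∑ k ∈ Finset.Icc 0 N, star (x k) ⬝ᵥ (W k *ᵥ x k) := by
    intro l'
    rw [Fquad, Finset.mul_sum, ← neg_add', ← Finset.sum_add_distrib]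
    congr 1
    refine Finset.sum_congr rfl fun k hk => ?_
    rw [aux_shift _ _ _ _ _ (hW k).1, hx k (Finset.mem_Icc.1 hk).2]
  rw [h l, h nu]
  push_cast
  ring

lemma aux_disc (A B C D W : ℕ → Matrix (Fin n) (Fin n) ℂ) (hW : ∀ k, (W k).PosDef)
    (l nu : ℝ) (hl : l ≤ nu) (N : ℕ) (h : DisconjugateOn A B C D W nu 0 N) :
    DisconjugateOn A B C D W l 0 N := by
  intro x u hx h0 hN hne
  obtain ⟨h1, h2⟩ := h x u hx h0 hN hne
  have hs : (0 : ℂ) ≤ ∑ k ∈ Finset.Icc 0 N, star (x k) ⬝ᵥ (W k *ᵥ x k) :=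
    Finset.sum_nonneg fun k _ => (hW k).posSemidef.dotProduct_mulVec_nonneg _
  rw [aux_Fshift A B C D W hW l nu x u N fun k hk => hx k (Nat.zero_le _) hk]
  obtain ⟨h3, h4⟩ := Complex.le_def.1 hs
  simp only [Complex.zero_re, Complex.zero_im] at h3 h4
  rw [Complex.add_re, Complex.add_im, Complex.re_ofReal_mul, Complex.im_ofReal_mul, ← h4, h1]
  refine ⟨by simp, ?_⟩
  have := mul_nonneg (sub_nonneg.2 hl) h3
  linarith

lemma aux_Slam (S : ℕ → Matrix (Fin n ⊕ Fin n) (Fin n ⊕ Fin n) ℂ)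
    (A B C D W : ℕ → Matrix (Fin n) (Fin n) ℂ)
    (hblocks : ∀ k, S k = Matrix.fromBlocks (A k) (B k) (C k) (D k)) (l : ℂ) (k : ℕ) :
    S k + l • Vmat S W k = Matrix.fromBlocks (A k) (B k) (C k + l • (W k * A k))
      (D k + l • (W k * B k)) := by
  rw [Vmat, hblocks, Jmat, PsiMat, fromBlocks_multiply, fromBlocks_multiply, fromBlocks_neg,
    fromBlocks_smul, fromBlocks_add]
  simp

lemma aux_sym_lam (A B C D W : Matrix (Fin n) (Fin n) ℂ) (hW : W.IsHermitian) (l : ℝ)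
    (h : Aᴴ * C = Cᴴ * A ∧ Bᴴ * D = Dᴴ * B ∧ Aᴴ * D - Cᴴ * B = 1) :
    Aᴴ * (C + (l : ℂ) • (W * A)) = (C + (l : ℂ) • (W * A))ᴴ * A ∧
    Bᴴ * (D + (l : ℂ) • (W * B)) = (D + (l : ℂ) • (W * B))ᴴ * B ∧
    Aᴴ * (D + (l : ℂ) • (W * B)) - (C + (l : ℂ) • (W * A))ᴴ * B = 1 := by
  obtain ⟨h1, h2, h3⟩ := h
  have hc : ∀ (X Y Z : Matrix (Fin n) (Fin n) ℂ),
      (X + (l : ℂ) • (W * Y))ᴴ * Z = Xᴴ * Z + (l : ℂ) • (Yᴴ * W * Z) := fun X Y Z => by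
    rw [conjTranspose_add, conjTranspose_smul, conjTranspose_mul, hW.eq, Matrix.add_mul,
      Matrix.smul_mul]
    simp
  simp only [hc, Matrix.mul_add, Matrix.mul_smul, ← Matrix.mul_assoc, h1, h2, true_and]
  rw [← h3]
  abel

lemma aux_pos (A B C D W P L Q : ℕ → Matrix (Fin n) (Fin n) ℂ) (l : ℝ) (M : ℕ)
    (hdis : ∀ N, DisconjugateOn A B C D W l 0 N)
    (h3 : ∀ k, (A k)ᴴ * (D k + (l : ℂ) • (W k * B k))
      - (C k + (l : ℂ) • (W k * A k))ᴴ * B k = 1)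
    (hj : ∀ i, JStep (A (M + i)) (B (M + i)) (C (M + i) + (l : ℂ) • (W (M + i) * A (M + i)))
      (D (M + i) + (l : ℂ) • (W (M + i) * B (M + i))) (P i) (L i) (Q i)) :
    ∀ (m : ℕ) (x : ℕ → Fin n → ℂ), x 0 = 0 → x (m + 1) = 0 → x m ≠ 0 →
      0 < ∑ i ∈ Finset.range (m + 1), termF (P i) (L i) (Q i) (x i) (x (i + 1)) := by
  intro m y hy0 hym hyne
  set x : ℕ → Fin n → ℂ := fun j => if j ≤ M then 0 else y (j - M) with hx
  set u : ℕ → Fin n → ℂ := fun j => if j ≤ M then 0 else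
    -((L (j - 1 - M))ᴴ *ᵥ x (j - 1)) + Q (j - 1 - M) *ᵥ x j with hu
  have hxM : ∀ i, x (M + i) = y i := by
    intro i
    rcases Nat.eq_zero_or_pos i with rfl | hi
    · simp [hx, hy0]
    · have : ¬ (M + i ≤ M) := by omega
      simp only [hx, this, if_false]
      congr 1; omega
  have hx0 : ∀ j, j ≤ M → x j = 0 := fun j hj => by simp [hx, hj]
  have hu0 : ∀ j, j ≤ M → u j = 0 := fun j hj => by simp [hu, hj]
  have huM : ∀ i, u (M + i + 1) = -((L i)ᴴ *ᵥ y i) + Q i *ᵥ y (i + 1) := by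
    intro i
    have h1 : ¬ (M + i + 1 ≤ M) := by omega
    have h2 : M + i + 1 - 1 - M = i := by omega
    have h4 : M + i + 1 - 1 = M + i := by omega
    simp only [hu, h1, if_false, h2]
    rw [h4, hxM, show M + i + 1 = M + (i + 1) by omega, hxM]
  have hadmM : ∀ i, y i = A (M + i) *ᵥ y (i + 1) + B (M + i) *ᵥ u (M + i + 1) := by
    intro i
    rw [huM, mulVec_add, mulVec_neg, mulVec_mulVec, mulVec_mulVec, (hj i).hBL, (hj i).hBQ,
      neg_mulVec, neg_mulVec, one_mulVec]
    abel
  have hadm : ∀ k, x k = A k *ᵥ x (k + 1) + B k *ᵥ u (k + 1) := by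
    intro k
    rcases Nat.lt_or_ge k M with hk | hk
    · rw [hx0 k (by omega), hx0 (k + 1) hk, hu0 (k + 1) hk]; simp
    · obtain ⟨i, rfl⟩ := Nat.exists_eq_add_of_le hk
      rw [hxM, show M + i + 1 = M + (i + 1) by omega, hxM]
      exact hadmM i
  obtain ⟨h1, h2⟩ := hdis (M + m) x u (fun k _ _ => hadm k) (hx0 0 (Nat.zero_le _))
    (by rw [show M + m + 1 = M + (m + 1) by omega, hxM]; exact hym)
    ⟨M + m, Nat.zero_le _, by omega, by rw [hxM]; exact hyne⟩
  have hF : Fquad A B C D W l x u 0 (M + m)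
      = ∑ i ∈ Finset.range (m + 1), termF (P i) (L i) (Q i) (y i) (y (i + 1)) := by
    have hI : Finset.Icc 0 (M + m) = Finset.range (M + (m + 1)) := by
      ext k; simp; omega
    rw [Fquad, hI, Finset.sum_range_add, Finset.sum_eq_zero, zero_add, ← Finset.sum_neg_distrib]
    · refine Finset.sum_congr rfl fun i _ => ?_
      have hx1 : x (M + i + 1) = y (i + 1) := by
        rw [show M + i + 1 = M + (i + 1) by omega, hxM]
      rw [hx1, aux_term (hj i) (y i) (y (i + 1)) _ (hadmM i) (h3 _), neg_neg]
    · intro k hk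
      have hk := Finset.mem_range.1 hk
      rw [hx0 (k + 1) hk, hu0 (k + 1) hk]; simp
  rw [← hF]
  rw [Complex.lt_def]
  exact ⟨h2, h1.symm⟩

lemma aux_Bunit (B D : ℕ → Matrix (Fin n) (Fin n) ℂ) (h : EventuallyControllable B D) :
    ∃ M, ∀ k, M ≤ k → IsUnit (B k) := by
  obtain ⟨N, h⟩ := h
  refine ⟨N, fun k hk => ?_⟩
  rw [← Matrix.mulVec_injective_iff_isUnit]
  have : ∀ v, B k *ᵥ v = 0 → v = 0 := by
    intro v hv
    have := h k (k + 1) hk (by omega) (fun j => if j = k + 1 then v else D k *ᵥ v) (by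
      intro j h1 h2
      have : j = k := by omega
      subst this
      simp [hv]) (k + 1) (by omega) le_rfl
    simpa using this
  intro v w hvw
  have := this (v - w) (by rw [mulVec_sub]; exact sub_eq_zero.2 hvw)
  exact sub_eq_zero.1 this

lemma aux_wr (X U Xt Ut : Matrix (Fin n) (Fin n) ℂ) :
    (Matrix.fromRows X U)ᴴ * Jmat n * Matrix.fromRows Xt Ut = Xᴴ * Ut - Uᴴ * Xt := by
  rw [Jmat, conjTranspose_fromRows_eq_fromCols_conjTranspose, fromCols_mul_fromBlocks,
    fromCols_mul_fromRows]
  simp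
  abel

lemma aux_rows (A B C D X U X' U' : Matrix (Fin n) (Fin n) ℂ) :
    Matrix.fromRows X U = Matrix.fromBlocks A B C D * Matrix.fromRows X' U' ↔
      (X = A * X' + B * U' ∧ U = C * X' + D * U') := by
  rw [fromBlocks_mul_fromRows]
  constructor
  · intro h
    exact fromRows_inj h
  · rintro ⟨h1, h2⟩
    rw [h1, h2]

lemma aux_rank (X U : Matrix (Fin n) (Fin n) ℂ) : X.rank ≤ (Matrix.fromRows X U).rank := by
  let E : Matrix (Fin n) (Fin n ⊕ Fin n) ℂ := Matrix.fromCols 1 0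
  let F : Matrix (Fin n ⊕ Fin n) (Fin n) ℂ := Matrix.fromRows X U
  have h2 : E * F = X := by
    have := fromCols_mul_fromRows (1 : Matrix (Fin n) (Fin n) ℂ) (0 : Matrix (Fin n) (Fin n) ℂ) X U
    rw [Matrix.one_mul, Matrix.zero_mul, add_zero] at this
    exact this
  have h3 := rank_mul_le_right E F
  rw [h2] at h3
  exact h3

lemma aux_final (S : ℕ → Matrix (Fin n ⊕ Fin n) (Fin n ⊕ Fin n) ℂ)
    (A B C D W : ℕ → Matrix (Fin n) (Fin n) ℂ)
    (hS : ∀ k, (S k)ᴴ * Jmat n * S k = Jmat n)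
    (hblocks : ∀ k, S k = Matrix.fromBlocks (A k) (B k) (C k) (D k))
    (hW : ∀ k, (W k).PosDef) (l : ℝ)
    (hdis : ∀ N, DisconjugateOn A B C D W l 0 N)
    (hctrl : EventuallyControllable B D) :
    ∃ Xt Ut : ℕ → Matrix (Fin n) (Fin n) ℂ, IsRecessive S W B l Xt Ut := by
  obtain ⟨M, hM⟩ := aux_Bunit B D hctrl
  have hsym := fun k => aux_sym_lam (A k) (B k) (C k) (D k) (W k) (hW k).1 l
    ((aux_sympl _ _ _ _).1 (by rw [← hblocks]; exact hS k))
  have hj := fun i => aux_jstep (A (M + i)) (B (M + i))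
      (C (M + i) + (l : ℂ) • (W (M + i) * A (M + i)))
      (D (M + i) + (l : ℂ) • (W (M + i) * B (M + i))) (hM _ (by omega))
      (hsym _).1 (hsym _).2.1 (hsym _).2.2
  generalize hPd : (fun i => -((D (M + i) + (l : ℂ) • (W (M + i) * B (M + i))) * (B (M + i))⁻¹)) = P
  generalize hLd : (fun i => -((B (M + i))ᴴ)⁻¹) = L
  generalize hQd : (fun i => -((B (M + i))⁻¹ * A (M + i))) = Q
  replace hj : ∀ i, JStep (A (M + i)) (B (M + i))
      (C (M + i) + (l : ℂ) • (W (M + i) * A (M + i)))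
      (D (M + i) + (l : ℂ) • (W (M + i) * B (M + i))) (P i) (L i) (Q i) := by
    intro i
    rw [← hPd, ← hLd, ← hQd]
    exact hj i
  obtain ⟨R, X, hRH, hXu, hX0, hNp, hLX, hRX, hY⟩ := aux_core P L Q (fun i => (hj i).hP)
    (fun i => (hj i).hQ) (fun i => (hj i).hL)
    (aux_pos A B C D W P L Q l M hdis (fun k => (hsym k).2.2) hj)
  set Sl := fun k => S k + (l : ℂ) • Vmat S W k with hSl
  have hSlb : ∀ k, Sl k = _ := fun k => aux_Slam S A B C D W hblocks l k
  have hSlJ : ∀ k, (Sl k)ᴴ * Jmat n * Sl k = Jmat n := fun k => by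
    rw [hSlb]; exact (aux_sympl _ _ _ _).2 (hsym k)
  obtain ⟨Z, hZ, hZz⟩ := aux_extend Sl (M + 1)
    (fun i => Matrix.fromRows (X i) (-(R i * X i))) (by
      intro i
      rw [hSlb, aux_rows]
      rw [show M + 1 + i = M + (i + 1) by omega]
      rw [aux_sol (hj (i + 1))]
      constructor
      · rw [hLX]; noncomm_ring
      · rw [← hRX]; noncomm_ring)
  have hZr : ∀ k, Matrix.fromRows (Z k).toRows₁ (Z k).toRows₂ = Z k := fun k => fromRows_toRows _
  have hXt : ∀ i, (Z (M + 1 + i)).toRows₁ = X i := fun i => by rw [hZz]; rfl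
  have hUt : ∀ i, (Z (M + 1 + i)).toRows₂ = -(R i * X i) := fun i => by rw [hZz]; rfl
  refine ⟨fun k => (Z k).toRows₁, fun k => (Z k).toRows₂, ⟨?_, ?_⟩, ⟨M + 1, ?_⟩, ?_⟩
  · intro k
    simp only [hZr]
    exact hZ k
  · simp only [hZr]
    have hJc : ∀ k, (Z k)ᴴ * Jmat n * Z k = (Z (k + 1))ᴴ * Jmat n * Z (k + 1) := by
      intro k
      rw [hZ k, conjTranspose_mul]
      calc _ = (Z (k + 1))ᴴ * ((Sl k)ᴴ * Jmat n * Sl k) * Z (k + 1) := by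
            simp only [Matrix.mul_assoc]
        _ = _ := by rw [hSlJ]
    have hdJ : IsUnit (Jmat n).det := by
      apply Matrix.isUnit_det_of_right_inverse (B := -Jmat n)
      rw [Jmat, fromBlocks_neg, fromBlocks_multiply]
      simp
    have hdu : ∀ k, IsUnit (Sl k).det := by
      intro k
      have h := congrArg det (hSlJ k)
      rw [det_mul] at h
      rw [← h] at hdJ
      exact isUnit_of_mul_isUnit_right hdJ
    have hrc : ∀ k, (Z k).rank = (Z (k + 1)).rank := by
      intro k
      conv_lhs => rw [hZ k]
      exact rank_mul_eq_right_of_isUnit_det _ _ (hdu k)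
    intro k
    constructor
    · rw [aux_const (fun k => (Z k).rank) hrc k (M + 1 + 0)]
      apply le_antisymm
      · simpa using rank_le_card_width (Z (M + 1 + 0))
      · have h1 : ((Z (M + 1 + 0)).toRows₁).rank = n := by
          rw [hXt, hX0]; simp
        have h2 : ((Z (M + 1 + 0)).toRows₁).rank ≤ (Z (M + 1 + 0)).rank := by
          have h4 := aux_rank (Z (M + 1 + 0)).toRows₁ (Z (M + 1 + 0)).toRows₂
          rwa [hZr] at h4
        omega
    · rw [aux_const (fun k => (Z k)ᴴ * Jmat n * Z k) hJc k (M + 1 + 0)]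
      rw [hZz, aux_wr, hX0]
      simp [(hRH 0).eq]
  · intro k hk
    obtain ⟨i, rfl⟩ := Nat.exists_eq_add_of_le hk
    simp only [hXt, show M + 1 + i + 1 = M + 1 + (i + 1) by omega]
    refine ⟨hXu i, ?_⟩
    have hB : B (M + 1 + i) = -((L (i + 1))ᴴ)⁻¹ := by
      rw [show M + 1 + i = M + (i + 1) by omega]; exact (hj (i + 1)).hB
    have hLu := (hj (i + 1)).hL
    have e1 : (X (i + 1))ᴴ * (L (i + 1))ᴴ = (X i)ᴴ * (P (i + 1) - R i) := by
      have := congrArg conjTranspose (hLX i)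
      rwa [conjTranspose_mul, conjTranspose_mul, (hNp i).1.eq] at this
    have e2 : ((L (i + 1))ᴴ)⁻¹ * ((X (i + 1))ᴴ)⁻¹ = (P (i + 1) - R i)⁻¹ * ((X i)ᴴ)⁻¹ := by
      rw [← Matrix.mul_inv_rev, e1, Matrix.mul_inv_rev]
    have e3 : -((X i)⁻¹ * B (M + 1 + i) * ((X (i + 1))ᴴ)⁻¹)
        = (X i)⁻¹ * (P (i + 1) - R i)⁻¹ * ((X i)⁻¹)ᴴ := by
      rw [hB, conjTranspose_nonsing_inv, Matrix.mul_assoc (X i)⁻¹, Matrix.mul_assoc (X i)⁻¹,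
        ← e2]
      noncomm_ring
    rw [e3]
    exact (hNp i).inv.posSemidef.mul_mul_conjTranspose_same _
  · intro X2 U2 hcb hnorm
    have hstep : ∀ i, U2 (M + 1 + i)
        = -(P (i + 1) * X2 (M + 1 + i)) + L (i + 1) * X2 (M + 1 + (i + 1)) := by
      intro i
      have h1 : Matrix.fromRows (X2 (M + 1 + i)) (U2 (M + 1 + i))
          = Sl (M + 1 + i) * Matrix.fromRows (X2 (M + 1 + i + 1)) (U2 (M + 1 + i + 1)) :=
        hcb.1 (M + 1 + i)
      rw [hSlb, aux_rows] at h1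
      rw [show M + 1 + i + 1 = M + 1 + (i + 1) by omega] at h1
      have h2 := hj (i + 1)
      rw [show M + (i + 1) = M + 1 + i by omega] at h2
      exact ((aux_sol h2 _ _ _ _).1 h1).1
    have hU : ∀ i, U2 (M + 1 + i) = -(R i * X2 (M + 1 + i)) - ((X i)ᴴ)⁻¹ := by
      intro i
      have h1 := hnorm (M + 1 + i)
      simp only [hZr] at h1
      rw [hZz, aux_wr] at h1
      have h2 := congrArg conjTranspose h1
      simp only [conjTranspose_sub, conjTranspose_mul, conjTranspose_neg,
        conjTranspose_conjTranspose, conjTranspose_one, (hRH i).eq] at h2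
      have hu := aux_im (aux_uh (hXu i))
      have h3 : ((X i)ᴴ)⁻¹ = -(R i * X2 (M + 1 + i)) - U2 (M + 1 + i) := by
        calc ((X i)ᴴ)⁻¹ = ((X i)ᴴ)⁻¹ * 1 := by simp
          _ = ((X i)ᴴ)⁻¹ * (X i)ᴴ * (-(R i * X2 (M + 1 + i)) - U2 (M + 1 + i)) := by
            rw [← h2]; noncomm_ring
          _ = _ := by rw [hu, Matrix.one_mul]
      rw [h3]; abel
    obtain ⟨⟨i₀, hu⟩, hlim⟩ := hY (fun i => (X i)⁻¹ * X2 (M + 1 + i)) (by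
      intro i
      have hLu := (hj (i + 1)).hL
      have e1 : L (i + 1) * X2 (M + 1 + (i + 1))
          = (P (i + 1) - R i) * X2 (M + 1 + i) - ((X i)ᴴ)⁻¹ := by
        have := (hstep i).symm.trans (hU i)
        rw [neg_add_eq_iff_eq_add] at this
        rw [this]; noncomm_ring
      have e2 : (X (i + 1))⁻¹ = (X i)⁻¹ * (P (i + 1) - R i)⁻¹ * L (i + 1) := by
        apply Matrix.inv_eq_left_inv
        rw [Matrix.mul_assoc, hLX]
        calc _ = (X i)⁻¹ * ((P (i + 1) - R i)⁻¹ * (P (i + 1) - R i)) * X i := by noncomm_ring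
          _ = 1 := by rw [aux_im (hNp i).isUnit, Matrix.mul_one, aux_im (hXu i)]
      rw [e2, Matrix.mul_assoc, e1, Matrix.mul_sub]
      congr 1
      rw [Matrix.mul_assoc, ← Matrix.mul_assoc _ (P (i + 1) - R i), aux_im (hNp i).isUnit,
        Matrix.one_mul])
    have hXY : ∀ i, X2 (M + 1 + i) = X i * ((X i)⁻¹ * X2 (M + 1 + i)) := fun i => by
      rw [← Matrix.mul_assoc, aux_mi (hXu i), Matrix.one_mul]
    refine ⟨⟨M + 1 + i₀, fun k hk => ?_⟩, ?_⟩
    · obtain ⟨i, rfl⟩ : ∃ i, k = M + 1 + i := ⟨k - (M + 1), by omega⟩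
      rw [hXY]
      exact (hXu i).mul (hu i (by omega))
    · rw [← tendsto_add_atTop_iff_nat (M + 1)]
      refine hlim.congr fun i => ?_
      rw [add_comm i (M + 1)]
      beta_reduce
      rw [hXt, Matrix.mul_inv_rev, Matrix.nonsing_inv_nonsing_inv _
        ((Matrix.isUnit_iff_isUnit_det _).1 (hXu i))]

end Core

/-- Corollary on disconjugacy: under the strong Atkinson condition, if `(S_ν)`
is disconjugate on `[0,∞)` and eventually controllable, then for every real `λ ≤ ν` the
system `(S_λ)` is disconjugate on `[0,∞)` and possesses a recessive solution. -/
theorem statement12 {n : ℕ} (hn : 1 ≤ n)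
    (S : ℕ → Matrix (Fin n ⊕ Fin n) (Fin n ⊕ Fin n) ℂ)
    (A B C D W : ℕ → Matrix (Fin n) (Fin n) ℂ)
    (hS : ∀ k, (S k)ᴴ * Jmat n * S k = Jmat n)
    (hblocks : ∀ k, S k = Matrix.fromBlocks (A k) (B k) (C k) (D k))
    (hW : ∀ k, (W k).PosDef)
    (hAtk : StrongAtkinson S W)
    (nu : ℝ)
    (hdis : ∀ N, DisconjugateOn A B C D W nu 0 N)
    (hctrl : EventuallyControllable B D) :
    ∀ lam : ℝ, lam ≤ nu →
      (∀ N, DisconjugateOn A B C D W lam 0 N) ∧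
        ∃ Xt Ut : ℕ → Matrix (Fin n) (Fin n) ℂ, IsRecessive S W B lam Xt Ut := by
  intro lam hlam
  have h := fun N => aux_disc A B C D W hW lam nu hlam N (hdis N)
  exact ⟨h, aux_final S A B C D W hS hblocks hW lam h hctrl⟩
end

section
/- (Existence of the recessive solution.) Let ν ∈ ℝ be such that system (S_ν) is nonoscillatory and eventually controllable. Then (S_ν) possesses a recessive solution Z̃ = (X̃; Ũ) : ℕ → ℂ^{2n×n}. -/
open Matrix Filter
open scoped ComplexOrder

section core
variable {n : ℕ}

local notation "Mat" => Matrix (Fin n) (Fin n) ℂ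

lemma rs_complex_mono_conv (f : ℕ → ℂ) (c : ℂ) (h1 : ∀ l, f l ≤ f (l + 1)) (h2 : ∀ l, f l ≤ c) :
    ∃ a, Tendsto f atTop (nhds a) := by
  have hm : Monotone fun l => (f l).re := monotone_nat_of_le_succ fun l => (Complex.le_def.1 (h1 l)).1
  have hb : BddAbove (Set.range fun l => (f l).re) :=
    ⟨c.re, by rintro _ ⟨l, rfl⟩; exact (Complex.le_def.1 (h2 l)).1⟩
  have ht := tendsto_atTop_ciSup hm hb
  have ht2 := (Complex.continuous_ofReal.tendsto _).comp ht
  refine ⟨_, (ht2.add_const ((c.im : ℂ) * Complex.I)).congr ?_⟩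
  intro l
  simp only [Function.comp]
  rw [← (Complex.le_def.1 (h2 l)).2, Complex.re_add_im]

lemma rs_polar (H : Mat) (x y : Fin n → ℂ) :
    star x ⬝ᵥ H *ᵥ y = (star (x + y) ⬝ᵥ H *ᵥ (x + y)
      - Complex.I * (star (x + Complex.I • y) ⬝ᵥ H *ᵥ (x + Complex.I • y))
      - (1 - Complex.I) * (star x ⬝ᵥ H *ᵥ x + star y ⬝ᵥ H *ᵥ y)) / 2 := by
  simp only [star_add, star_smul, mulVec_add, mulVec_smul, add_dotProduct, dotProduct_add,
    smul_dotProduct, dotProduct_smul, smul_eq_mul, Complex.star_def, Complex.conj_I]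
  ring_nf
  simp only [Complex.I_sq, Complex.I_pow_three]
  ring

lemma rs_mono_conv (H : ℕ → Mat) (K : Mat) (h1 : ∀ l, (H (l + 1) - H l).PosSemidef)
    (h2 : ∀ l, (K - H l).PosSemidef) : ∃ L : Mat, Tendsto H atTop (nhds L) := by
  have hq : ∀ v : Fin n → ℂ, ∃ a, Tendsto (fun l => star v ⬝ᵥ H l *ᵥ v) atTop (nhds a) := by
    intro v
    apply rs_complex_mono_conv _ (star v ⬝ᵥ K *ᵥ v)
    · intro l
      have := (h1 l).dotProduct_mulVec_nonneg v
      rwa [sub_mulVec, dotProduct_sub, sub_nonneg] at this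
    · intro l
      have := (h2 l).dotProduct_mulVec_nonneg v
      rwa [sub_mulVec, dotProduct_sub, sub_nonneg] at this
  have he : ∀ i j, ∃ a, Tendsto (fun l => H l i j) atTop (nhds a) := by
    intro i j
    obtain ⟨a1, ha1⟩ := hq (Pi.single i 1 + Pi.single j 1)
    obtain ⟨a2, ha2⟩ := hq (Pi.single i 1 + Complex.I • Pi.single j 1)
    obtain ⟨a3, ha3⟩ := hq (Pi.single i 1)
    obtain ⟨a4, ha4⟩ := hq (Pi.single j 1)
    refine ⟨_, (((ha1.sub (ha2.const_mul Complex.I)).sub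
      ((ha3.add ha4).const_mul (1 - Complex.I))).div_const 2).congr ?_⟩
    intro l
    rw [← rs_polar]
    rw [← Pi.single_star]
    simp
  choose a ha using he
  refine ⟨Matrix.of a, ?_⟩
  exact tendsto_pi_nhds.2 fun i => tendsto_pi_nhds.2 fun j => ha i j

lemma rs_inv_tendsto {H : ℕ → Mat} {L : Mat} (h : Tendsto H atTop (nhds L)) (hL : IsUnit L) :
    Tendsto (fun l => (H l)⁻¹) atTop (nhds L⁻¹) := by
  have hd : L.det ≠ 0 := ((Matrix.isUnit_iff_isUnit_det _).1 hL).ne_zero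
  simp only [Matrix.inv_def, Ring.inverse_eq_inv']
  have c1 : Continuous fun M : Mat => M.det := continuous_id.matrix_det
  have c2 : Continuous fun M : Mat => M.adjugate := continuous_id.matrix_adjugate
  exact (((c1.tendsto L).comp h).inv₀ hd).smul ((c2.tendsto L).comp h)

lemma rs_posSemidef_lim {H : ℕ → Mat} {L : Mat} (h : Tendsto H atTop (nhds L))
    (hp : ∀ l, (H l).PosSemidef) : L.PosSemidef := by
  apply Matrix.PosSemidef.of_dotProduct_mulVec_nonneg
  · have h2 : Tendsto (fun l => (H l)ᴴ) atTop (nhds Lᴴ) :=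
      ((continuous_id.matrix_conjTranspose).tendsto L).comp h
    have h3 : (fun l => (H l)ᴴ) = H := funext fun l => (hp l).1
    rw [h3] at h2
    exact tendsto_nhds_unique h2 h
  · intro x
    have c : Continuous fun M : Mat => star x ⬝ᵥ M *ᵥ x :=
      Continuous.dotProduct continuous_const (continuous_id.matrix_mulVec continuous_const)
    exact ge_of_tendsto ((c.tendsto L).comp h)
      (Eventually.of_forall fun l => (hp l).dotProduct_mulVec_nonneg x)

lemma rs_inv_anti {X Y : Mat} (hX : X.PosDef) (h : (Y - X).PosSemidef) :
    Y.PosDef ∧ (X⁻¹ - Y⁻¹).PosSemidef := by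
  have hY : Y.PosDef := by
    have := hX.add_posSemidef h
    rwa [add_sub_cancel] at this
  refine ⟨hY, ?_⟩
  let _ := hX.inv.isUnit.invertible
  let _ := hY.isUnit.invertible
  have h1 := (Matrix.PosDef.fromBlocks₁₁ (1 : Mat) Y hX.inv).2 (by
    rw [Matrix.nonsing_inv_nonsing_inv _ ((Matrix.isUnit_iff_isUnit_det _).1 hX.isUnit)]
    simpa using h)
  have h2 := (Matrix.PosDef.fromBlocks₂₂ X⁻¹ (1 : Mat) hY).1 h1
  simpa using h2

lemma rs_conj {H G : Mat} (hH : H.PosDef) (hG : IsUnit G) : (Gᴴ * H * G).PosDef :=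
  hH.conjTranspose_mul_mul_same (Matrix.mulVec_injective_iff_isUnit.2 hG)

/-- backward Riccati iterates -/
noncomputable def rsB (T G : ℕ → Mat) : ℕ → ℕ → Mat
  | 0, _ => 0
  | l + 1, k => (G k)ᴴ * (T (k + 1) - rsB T G l (k + 1))⁻¹ * G k

/-- forward pivots -/
noncomputable def rsP (T G : ℕ → Mat) : ℕ → Mat
  | 0 => T 0
  | k + 1 => T (k + 1) - G k * (rsP T G k)⁻¹ * (G k)ᴴ

lemma rs_pivot_form (T G : ℕ → Mat) (hT : ∀ k, (T k).IsHermitian)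
    (hpos : ∀ N, ∀ y : ℕ → Fin n → ℂ, (∀ j, N < j → y j = 0) → y N ≠ 0 →
      0 < ∑ j ∈ Finset.range (N + 1), star (y j) ⬝ᵥ T j *ᵥ y j
        - ∑ j ∈ Finset.range N, (star (y (j + 1)) ⬝ᵥ G j *ᵥ y j
          + star (y j) ⬝ᵥ (G j)ᴴ *ᵥ y (j + 1))) (k : ℕ) :
    (rsP T G k).PosDef ∧ ∀ v : Fin n → ℂ, ∃ y : ℕ → Fin n → ℂ, (∀ j, k < j → y j = 0) ∧ y k = v ∧
      ∑ j ∈ Finset.range (k + 1), star (y j) ⬝ᵥ T j *ᵥ y j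
        - ∑ j ∈ Finset.range k, (star (y (j + 1)) ⬝ᵥ G j *ᵥ y j
          + star (y j) ⬝ᵥ (G j)ᴴ *ᵥ y (j + 1)) = star v ⬝ᵥ rsP T G k *ᵥ v := by
  suffices h : (rsP T G k).IsHermitian ∧ ∀ v : Fin n → ℂ, ∃ y : ℕ → Fin n → ℂ,
      (∀ j, k < j → y j = 0) ∧ y k = v ∧
      ∑ j ∈ Finset.range (k + 1), star (y j) ⬝ᵥ T j *ᵥ y j
        - ∑ j ∈ Finset.range k, (star (y (j + 1)) ⬝ᵥ G j *ᵥ y j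
          + star (y j) ⬝ᵥ (G j)ᴴ *ᵥ y (j + 1)) = star v ⬝ᵥ rsP T G k *ᵥ v by
    refine ⟨Matrix.PosDef.of_dotProduct_mulVec_pos h.1 ?_, h.2⟩
    intro v hv
    obtain ⟨y, h1, h2, h3⟩ := h.2 v
    rw [← h3]
    exact hpos k y h1 (by rwa [h2])
  induction k with
  | zero =>
    refine ⟨hT 0, fun v => ⟨fun j => if j = 0 then v else 0, ?_, ?_, ?_⟩⟩
    · intro j hj; simp [hj.ne']
    · simp
    · simp [rsP]
  | succ k ih =>
    have hpd : (rsP T G k).PosDef := by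
      refine Matrix.PosDef.of_dotProduct_mulVec_pos ih.1 ?_
      intro v hv
      obtain ⟨y, h1, h2, h3⟩ := ih.2 v
      rw [← h3]
      exact hpos k y h1 (by rwa [h2])
    refine ⟨?_, ?_⟩
    · exact (hT (k + 1)).sub (Matrix.isHermitian_mul_mul_conjTranspose _ hpd.inv.1)
    · intro v
      obtain ⟨y, h1, h2, h3⟩ := ih.2 ((rsP T G k)⁻¹ *ᵥ ((G k)ᴴ *ᵥ v))
      refine ⟨Function.update y (k + 1) v, ?_, ?_, ?_⟩
      · intro j hj
        rw [Function.update_of_ne (by omega)]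
        exact h1 j (by omega)
      · simp
      · have e1 : ∑ j ∈ Finset.range (k + 1), star (Function.update y (k + 1) v j) ⬝ᵥ
            T j *ᵥ Function.update y (k + 1) v j
            = ∑ j ∈ Finset.range (k + 1), star (y j) ⬝ᵥ T j *ᵥ y j := by
          apply Finset.sum_congr rfl
          intro j hj
          rw [Finset.mem_range] at hj
          rw [Function.update_of_ne (by omega)]
        have e2 : ∑ j ∈ Finset.range k, (star (Function.update y (k + 1) v (j + 1)) ⬝ᵥ
            G j *ᵥ Function.update y (k + 1) v j + star (Function.update y (k + 1) v j) ⬝ᵥ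
            (G j)ᴴ *ᵥ Function.update y (k + 1) v (j + 1))
            = ∑ j ∈ Finset.range k, (star (y (j + 1)) ⬝ᵥ G j *ᵥ y j
              + star (y j) ⬝ᵥ (G j)ᴴ *ᵥ y (j + 1)) := by
          apply Finset.sum_congr rfl
          intro j hj
          rw [Finset.mem_range] at hj
          rw [Function.update_of_ne (by omega), Function.update_of_ne (by omega)]
        have e3 := sub_eq_iff_eq_add.1 h3
        rw [Finset.sum_range_succ _ (k + 1), e1, e3, Finset.sum_range_succ _ k, e2]
        have hu : IsUnit (rsP T G k).det := (Matrix.isUnit_iff_isUnit_det _).1 hpd.isUnit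
        have e4 : rsP T G k *ᵥ (rsP T G k)⁻¹ *ᵥ (G k)ᴴ *ᵥ v = (G k)ᴴ *ᵥ v := by
          rw [Matrix.mulVec_mulVec, Matrix.mul_nonsing_inv _ hu, Matrix.one_mulVec]
        simp only [Function.update_self, Function.update_of_ne (Nat.lt_succ_self k).ne, h2, e4]
        simp only [rsP, sub_mulVec, dotProduct_sub, ← Matrix.mulVec_mulVec]
        ring

lemma rs_back (T G : ℕ → Mat) (hG : ∀ k, IsUnit (G k))
    (hP : ∀ k, (rsP T G k).PosDef) (l : ℕ) : ∀ k,
    (rsP T G k - rsB T G l k).PosDef ∧ (rsB T G (l + 1) k - rsB T G l k).PosSemidef := by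
  have key : ∀ l k, (rsP T G (k + 1) - rsB T G l (k + 1)).PosDef →
      (T (k + 1) - rsB T G l (k + 1)).PosDef ∧ (rsP T G k - rsB T G (l + 1) k).PosDef := by
    intro l k h
    have hk := hP k
    set P := rsP T G k with hPdef
    have hPu : IsUnit P.det := (Matrix.isUnit_iff_isUnit_det _).1 hk.isUnit
    have hGu : IsUnit (G k).det := (Matrix.isUnit_iff_isUnit_det _).1 (hG k)
    have hGu' : IsUnit ((G k)ᴴ).det := by
      rw [Matrix.det_conjTranspose]; exact hGu.star
    have hGH : IsUnit (G k)ᴴ := (Matrix.isUnit_iff_isUnit_det _).2 hGu'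
    have hX : (G k * P⁻¹ * (G k)ᴴ).PosDef := by
      have := rs_conj hk.inv hGH
      rwa [Matrix.conjTranspose_conjTranspose] at this
    set Q := T (k + 1) - rsB T G l (k + 1) with hQ
    have hQX : (Q - G k * P⁻¹ * (G k)ᴴ).PosDef := by
      have : Q - G k * P⁻¹ * (G k)ᴴ = rsP T G (k + 1) - rsB T G l (k + 1) := by
        rw [hQ, hPdef]; simp only [rsP]; abel
      rw [this]; exact h
    have hQp : Q.PosDef := (rs_inv_anti hX hQX.posSemidef).1
    refine ⟨hQp, ?_⟩
    have hXu : IsUnit (G k * P⁻¹ * (G k)ᴴ).det := (Matrix.isUnit_iff_isUnit_det _).1 hX.isUnit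
    have hQu : IsUnit Q.det := (Matrix.isUnit_iff_isUnit_det _).1 hQp.isUnit
    -- X⁻¹ - Q⁻¹ is positive semidefinite and invertible
    have hps := (rs_inv_anti hX hQX.posSemidef).2
    have hdiff : (G k * P⁻¹ * (G k)ᴴ)⁻¹ - Q⁻¹ =
        (G k * P⁻¹ * (G k)ᴴ)⁻¹ * (Q - G k * P⁻¹ * (G k)ᴴ) * Q⁻¹ := by
      rw [Matrix.mul_sub, Matrix.nonsing_inv_mul _ hXu, Matrix.sub_mul,
        Matrix.mul_nonsing_inv_cancel_right _ _ hQu, Matrix.one_mul]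
    have hunit : IsUnit ((G k * P⁻¹ * (G k)ᴴ)⁻¹ - Q⁻¹) := by
      rw [hdiff]
      exact (hX.inv.isUnit.mul hQX.isUnit).mul hQp.inv.isUnit
    have hpd := rs_conj (hps.posDef_iff_isUnit.2 hunit) (hG k)
    have : rsP T G k - rsB T G (l + 1) k =
        (G k)ᴴ * ((G k * P⁻¹ * (G k)ᴴ)⁻¹ - Q⁻¹) * G k := by
      rw [Matrix.mul_sub, Matrix.sub_mul, Matrix.mul_inv_rev, Matrix.mul_inv_rev,
        Matrix.nonsing_inv_nonsing_inv _ hPu]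
      simp only [rsB]
      congr 1
      rw [Matrix.mul_assoc, Matrix.mul_assoc, Matrix.mul_assoc, Matrix.nonsing_inv_mul _ hGu,
        Matrix.mul_one, Matrix.mul_nonsing_inv_cancel_left _ _ hGu']
    rw [this]; exact hpd
  have base : ∀ l k, (rsP T G k - rsB T G l k).PosDef := by
    intro l
    induction l with
    | zero => intro k; simpa [rsB] using hP k
    | succ l ih => intro k; exact (key l k (ih (k + 1))).2
  have tq : ∀ l k, (T (k + 1) - rsB T G l (k + 1)).PosDef := fun l k => (key l k (base l _)).1
  intro k
  refine ⟨base l k, ?_⟩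
  induction l generalizing k with
  | zero =>
    have := (rs_conj (tq 0 k).inv (hG k)).posSemidef
    simpa [rsB] using this
  | succ l ih =>
    have h1 : ((T (k + 1) - rsB T G l (k + 1)) - (T (k + 1) - rsB T G (l + 1) (k + 1))).PosSemidef := by
      rw [sub_sub_sub_cancel_left]; exact ih (k + 1)
    have h2 := ((rs_inv_anti (tq (l + 1) k) h1).2).conjTranspose_mul_mul_same (G k)
    rw [Matrix.mul_sub, Matrix.sub_mul] at h2
    exact h2

lemma rs_limit (T G : ℕ → Mat) (hG : ∀ k, IsUnit (G k))
    (hP : ∀ k, (rsP T G k).PosDef) :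
    ∃ H : ℕ → Mat, (∀ k, (H k).PosDef) ∧ (∀ k, G k * (H k)⁻¹ * (G k)ᴴ = T (k + 1) - H (k + 1)) ∧
      ∀ k, Tendsto (fun l => rsB T G l k) atTop (nhds (H k)) := by
  have hb := rs_back T G hG hP
  have hex : ∀ k, ∃ L : Mat, Tendsto (fun l => rsB T G l k) atTop (nhds L) := fun k =>
    rs_mono_conv _ (rsP T G k) (fun l => (hb l k).2) (fun l => (hb l k).1.posSemidef)
  choose H hH using hex
  have hle : ∀ k, (rsP T G k - H k).PosSemidef := fun k =>
    rs_posSemidef_lim ((hH k).const_sub _) (fun l => (hb l k).1.posSemidef)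
  have hGH : ∀ k, IsUnit (G k)ᴴ := fun k => (hG k).star
  have hTH : ∀ k, (T (k + 1) - H (k + 1)).PosDef := by
    intro k
    have hX : (G k * (rsP T G k)⁻¹ * (G k)ᴴ).PosDef := by
      have := rs_conj (hP k).inv (hGH k)
      rwa [Matrix.conjTranspose_conjTranspose] at this
    have := hX.add_posSemidef (hle (k + 1))
    have e : G k * (rsP T G k)⁻¹ * (G k)ᴴ + (rsP T G (k + 1) - H (k + 1)) = T (k + 1) - H (k + 1) := by
      simp only [rsP]; abel
    rwa [e] at this
  have hrec : ∀ k, H k = (G k)ᴴ * (T (k + 1) - H (k + 1))⁻¹ * G k := by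
    intro k
    have h1 : Tendsto (fun l => rsB T G (l + 1) k) atTop (nhds (H k)) :=
      (hH k).comp (tendsto_add_atTop_nat 1)
    have h2 : Tendsto (fun l => rsB T G (l + 1) k) atTop
        (nhds ((G k)ᴴ * (T (k + 1) - H (k + 1))⁻¹ * G k)) :=
      ((rs_inv_tendsto ((hH (k + 1)).const_sub _) (hTH k).isUnit).const_mul ((G k)ᴴ)).mul_const (G k)
    exact tendsto_nhds_unique h1 h2
  refine ⟨H, ?_, ?_, hH⟩
  · intro k; rw [hrec k]; exact rs_conj (hTH k).inv (hG k)
  · intro k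
    have hGu : IsUnit (G k).det := (Matrix.isUnit_iff_isUnit_det _).1 (hG k)
    have hGu' : IsUnit ((G k)ᴴ).det := (Matrix.isUnit_iff_isUnit_det _).1 (hGH k)
    rw [hrec k, Matrix.mul_inv_rev, Matrix.mul_inv_rev,
      Matrix.nonsing_inv_nonsing_inv _ ((Matrix.isUnit_iff_isUnit_det _).1 (hTH k).isUnit)]
    rw [Matrix.mul_assoc, Matrix.mul_assoc, Matrix.mul_assoc, Matrix.nonsing_inv_mul _ hGu',
        Matrix.mul_one, Matrix.mul_nonsing_inv_cancel_left _ _ hGu]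

lemma rs_posDef_sum (e : ℕ → Mat) (he : ∀ k, (e k).PosDef) (l k : ℕ) :
    (∑ j ∈ Finset.range (l + 1), (e (k + j))⁻¹).PosDef := by
  induction l with
  | zero => simpa using (he k).inv
  | succ l ih => rw [Finset.sum_range_succ]; exact ih.add_posSemidef (he _).inv.posSemidef

lemma rs_sum_id (T G H X : ℕ → Mat) (hH : ∀ k, (H k).PosDef)
    (hrec : ∀ k, G k * (H k)⁻¹ * (G k)ᴴ = T (k + 1) - H (k + 1))
    (hX : ∀ k, IsUnit (X k)) (hXr : ∀ k, (G k)ᴴ * X (k + 1) = H k * X k) (l : ℕ) : ∀ k,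
    (X k)ᴴ * (H k - rsB T G l k) * X k =
      (∑ j ∈ Finset.range (l + 1), ((X (k + j))ᴴ * H (k + j) * X (k + j))⁻¹)⁻¹ := by
  have he : ∀ k, ((X k)ᴴ * H k * X k).PosDef := fun k => rs_conj (hH k) (hX k)
  have hdet : ∀ {M : Mat}, IsUnit M → IsUnit M.det := fun h => (Matrix.isUnit_iff_isUnit_det _).1 h
  induction l with
  | zero =>
    intro k
    simp [rsB, Matrix.nonsing_inv_nonsing_inv _ (hdet (he k).isUnit)]
  | succ l ih =>
    intro k
    have ih' := ih (k + 1)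
    have hs := rs_posDef_sum (fun k => (X k)ᴴ * H k * X k) he l (k + 1)
    rw [Finset.sum_range_succ']
    simp only [add_zero]
    have hsum : ∑ j ∈ Finset.range (l + 1),
        ((X (k + (j + 1)))ᴴ * H (k + (j + 1)) * X (k + (j + 1)))⁻¹
        = ∑ j ∈ Finset.range (l + 1), ((X (k + 1 + j))ᴴ * H (k + 1 + j) * X (k + 1 + j))⁻¹ := by
      apply Finset.sum_congr rfl
      intro j _
      rw [show k + (j + 1) = k + 1 + j by ring]
    rw [hsum]
    set s := ∑ j ∈ Finset.range (l + 1), ((X (k + 1 + j))ᴴ * H (k + 1 + j) * X (k + 1 + j))⁻¹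
    have hek := he k
    set e := (X k)ᴴ * H k * X k with hedef
    have hX1 := hdet (hX (k + 1))
    have hX1' : IsUnit ((X (k + 1))ᴴ).det := hdet (hX (k + 1)).star
    have hHk := hdet (hH k).isUnit
    have hGs : (G k)ᴴ = H k * X k * (X (k + 1))⁻¹ := by
      rw [← hXr, Matrix.mul_nonsing_inv_cancel_right _ _ hX1]
    have hGn : G k = ((X (k + 1))ᴴ)⁻¹ * (X k)ᴴ * H k := by
      have := congrArg Matrix.conjTranspose hGs
      rw [Matrix.conjTranspose_conjTranspose, Matrix.conjTranspose_mul, Matrix.conjTranspose_mul,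
        (hH k).1.eq, Matrix.conjTranspose_nonsing_inv] at this
      rw [this, Matrix.mul_assoc]
    have hGG : (X (k + 1))ᴴ * (T (k + 1) - H (k + 1)) * X (k + 1) = e := by
      rw [← hrec, hGs, hGn, hedef]
      simp only [Matrix.mul_assoc, Matrix.mul_nonsing_inv_cancel_left _ _ hX1',
        Matrix.nonsing_inv_mul _ hX1, Matrix.mul_one]
      rw [Matrix.mul_nonsing_inv_cancel_left _ _ hHk]
    have hQ : (X (k + 1))ᴴ * (T (k + 1) - rsB T G l (k + 1)) * X (k + 1) = e + s⁻¹ := by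
      rw [← hGG, ← ih', ← Matrix.add_mul, ← Matrix.mul_add]
      congr 2; abel
    have hr : (e + s⁻¹).PosDef := hek.add_posSemidef hs.inv.posSemidef
    have hQi : (T (k + 1) - rsB T G l (k + 1))⁻¹ = X (k + 1) * (e + s⁻¹)⁻¹ * (X (k + 1))ᴴ := by
      rw [← hQ, Matrix.mul_inv_rev, Matrix.mul_inv_rev, Matrix.mul_assoc, Matrix.mul_assoc,
        Matrix.mul_nonsing_inv_cancel_left _ _ hX1, Matrix.nonsing_inv_mul_cancel_right _ _ hX1']
    have hb : (X k)ᴴ * rsB T G (l + 1) k * X k = e * (e + s⁻¹)⁻¹ * e := by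
      simp only [rsB]
      rw [hQi, hGs, hGn, hedef]
      simp only [Matrix.mul_assoc, Matrix.mul_nonsing_inv_cancel_left _ _ hX1',
        Matrix.nonsing_inv_mul_cancel_left _ _ hX1]
    rw [Matrix.mul_sub, Matrix.sub_mul, hb]
    symm
    apply Matrix.inv_eq_right_inv
    have h1 : s + e⁻¹ = s * (e + s⁻¹) * e⁻¹ := by
      rw [Matrix.mul_add, Matrix.add_mul, Matrix.mul_nonsing_inv_cancel_right _ _ (hdet hek.isUnit),
        Matrix.mul_nonsing_inv _ (hdet hs.isUnit), Matrix.one_mul]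
    have h2 : (s + e⁻¹) * (e * (e + s⁻¹)⁻¹ * e) = s * e := by
      rw [h1]
      simp only [Matrix.mul_assoc]
      rw [Matrix.nonsing_inv_mul_cancel_left _ _ (hdet hek.isUnit),
        Matrix.mul_nonsing_inv_cancel_left _ _ (hdet hr.isUnit)]
    rw [← hedef, Matrix.mul_sub, h2, Matrix.add_mul, Matrix.nonsing_inv_mul _ (hdet hek.isUnit)]
    abel

lemma rs_div (σ : ℕ → Mat) (Y : Mat) (hσ : ∀ l, IsUnit (σ l))
    (h : Tendsto (fun l => (σ l)⁻¹) atTop (nhds 0)) :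
    (∀ᶠ l in atTop, IsUnit (Y - σ l)) ∧ Tendsto (fun l => (Y - σ l)⁻¹) atTop (nhds 0) := by
  have h1 : Tendsto (fun l => (σ l)⁻¹ * Y - 1) atTop (nhds (-1)) := by
    have := (h.mul_const Y).sub_const 1
    simpa using this
  have hfac : ∀ l, Y - σ l = σ l * ((σ l)⁻¹ * Y - 1) := by
    intro l
    rw [Matrix.mul_sub, Matrix.mul_nonsing_inv_cancel_left _ _
      ((Matrix.isUnit_iff_isUnit_det _).1 (hσ l)), Matrix.mul_one]
  have hu : IsUnit (-1 : Mat) := isUnit_one.neg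
  constructor
  · have c1 : Continuous fun M : Mat => M.det := continuous_id.matrix_det
    have h2 := (c1.tendsto _).comp h1
    have h3 := h2.eventually_ne ((Matrix.isUnit_iff_isUnit_det _).1 hu).ne_zero
    filter_upwards [h3] with l hl
    rw [hfac]
    exact (hσ l).mul ((Matrix.isUnit_iff_isUnit_det _).2 (isUnit_iff_ne_zero.2 hl))
  · have h2 := (rs_inv_tendsto h1 hu).mul h
    rw [mul_zero] at h2
    refine h2.congr fun l => ?_
    rw [hfac l, Matrix.mul_inv_rev]

end core

section system
variable {n : ℕ}

local notation "Mat" => Matrix (Fin n) (Fin n) ℂ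

lemma rs_adj (M : Mat) (v w : Fin n → ℂ) : star (M *ᵥ v) ⬝ᵥ w = star v ⬝ᵥ Mᴴ *ᵥ w := by
  rw [Matrix.star_mulVec, Matrix.dotProduct_mulVec]

lemma rs_JJ : Jmat n * Jmat n = -1 := by
  simp [Jmat, Matrix.fromBlocks_multiply, ← Matrix.fromBlocks_one, Matrix.fromBlocks_neg]

lemma rs_symp_inv {S : Matrix (Fin n ⊕ Fin n) (Fin n ⊕ Fin n) ℂ} (h : Sᴴ * Jmat n * S = Jmat n) :
    S * (-(Jmat n * Sᴴ * Jmat n)) = 1 := by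
  apply mul_eq_one_comm.1
  rw [neg_mul, Matrix.mul_assoc, Matrix.mul_assoc, ← Matrix.mul_assoc Sᴴ, h, rs_JJ, neg_neg]

lemma rs_symp_unit {S : Matrix (Fin n ⊕ Fin n) (Fin n ⊕ Fin n) ℂ} (h : Sᴴ * Jmat n * S = Jmat n) :
    IsUnit S := by
  exact IsUnit.of_mul_eq_one _ (rs_symp_inv h)

lemma rs_symp' {S : Matrix (Fin n ⊕ Fin n) (Fin n ⊕ Fin n) ℂ} (h : Sᴴ * Jmat n * S = Jmat n) :
    S * Jmat n * Sᴴ = Jmat n := by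
  have h1 := congrArg (· * Jmat n) (rs_symp_inv h)
  simp only [mul_neg, neg_mul, Matrix.one_mul] at h1
  refine Eq.trans ?_ h1
  have : S * (Jmat n * Sᴴ * Jmat n) * Jmat n = S * Jmat n * Sᴴ * (Jmat n * Jmat n) := by
    simp only [Matrix.mul_assoc]
  rw [this, rs_JJ]
  simp

lemma rs_blocks {A B C D : Mat} (h : (fromBlocks A B C D)ᴴ * Jmat n * fromBlocks A B C D = Jmat n) :
    Aᴴ * D - Cᴴ * B = 1 ∧ Bᴴ * D = Dᴴ * B ∧ A * Bᴴ = B * Aᴴ := by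
  have h' := rs_symp' h
  simp only [Jmat, Matrix.fromBlocks_conjTranspose, Matrix.fromBlocks_multiply,
    Matrix.fromBlocks_inj] at h h'
  simp only [mul_zero, mul_neg, mul_one, zero_add, add_zero, neg_mul] at h h'
  obtain ⟨h1, h2, h3, h4⟩ := h
  obtain ⟨k1, k2, k3, k4⟩ := h'
  refine ⟨?_, ?_, ?_⟩
  · rw [← h2]; abel
  · rw [← sub_eq_zero, ← h4]; abel
  · rw [← sub_eq_zero, ← k1]; abel

lemma rs_loc {A B C D : Mat} (h : (fromBlocks A B C D)ᴴ * Jmat n * fromBlocks A B C D = Jmat n)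
    (hB : IsUnit B) : (-(D * B⁻¹)).IsHermitian ∧ (-(B⁻¹ * A)).IsHermitian ∧
      C - D * B⁻¹ * A = (-B⁻¹)ᴴ := by
  obtain ⟨h1, h2, h3⟩ := rs_blocks h
  have hb : IsUnit B.det := (Matrix.isUnit_iff_isUnit_det _).1 hB
  have hb' : IsUnit (Bᴴ).det := (Matrix.isUnit_iff_isUnit_det _).1 hB.star
  have e : D * B⁻¹ = (Bᴴ)⁻¹ * Dᴴ := by
    have : (Bᴴ)⁻¹ * (Bᴴ * D) * B⁻¹ = (Bᴴ)⁻¹ * (Dᴴ * B) * B⁻¹ := by rw [h2]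
    rwa [Matrix.nonsing_inv_mul_cancel_left _ _ hb', Matrix.mul_assoc, Matrix.mul_assoc,
      Matrix.mul_nonsing_inv _ hb, Matrix.mul_one] at this
  refine ⟨?_, ?_, ?_⟩
  · apply Matrix.IsHermitian.neg
    rw [Matrix.IsHermitian, Matrix.conjTranspose_mul, Matrix.conjTranspose_nonsing_inv, e]
  · apply Matrix.IsHermitian.neg
    rw [Matrix.IsHermitian, Matrix.conjTranspose_mul, Matrix.conjTranspose_nonsing_inv]
    have : B⁻¹ * (A * Bᴴ) * (Bᴴ)⁻¹ = B⁻¹ * (B * Aᴴ) * (Bᴴ)⁻¹ := by rw [h3]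
    rw [Matrix.nonsing_inv_mul_cancel_left _ _ hb, Matrix.mul_assoc, Matrix.mul_assoc,
      Matrix.mul_nonsing_inv _ hb', Matrix.mul_one] at this
    exact this.symm
  · have h1' := congrArg Matrix.conjTranspose h1
    simp only [Matrix.conjTranspose_sub, Matrix.conjTranspose_mul, Matrix.conjTranspose_conjTranspose,
      Matrix.conjTranspose_one] at h1'
    rw [e, Matrix.mul_assoc, sub_eq_iff_eq_add.1 h1', Matrix.mul_add,
      Matrix.nonsing_inv_mul_cancel_left _ _ hb', Matrix.conjTranspose_neg,
      Matrix.conjTranspose_nonsing_inv, Matrix.mul_one]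
    abel

lemma rs_sol {A B C D : Mat} (h : (fromBlocks A B C D)ᴴ * Jmat n * fromBlocks A B C D = Jmat n)
    (hB : IsUnit B) {X X' U U' : Mat} (hX : X = A * X' + B * U') (hU : U = C * X' + D * U') :
    (-B⁻¹)ᴴ * X' = U + -(D * B⁻¹) * X ∧ U' = -(-B⁻¹ * X) + -(B⁻¹ * A) * X' := by
  obtain ⟨-, -, h3⟩ := rs_loc h hB
  have hb : IsUnit B.det := (Matrix.isUnit_iff_isUnit_det _).1 hB
  constructor
  · rw [← h3, hU, hX]
    simp only [Matrix.sub_mul, Matrix.mul_add, Matrix.neg_mul, Matrix.mul_assoc,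
      Matrix.nonsing_inv_mul_cancel_left _ _ hb]
    abel
  · rw [hX]
    simp only [Matrix.mul_add, Matrix.neg_mul, Matrix.mul_assoc,
      Matrix.nonsing_inv_mul_cancel_left _ _ hb]
    abel

lemma rs_term {A B C D : Mat} (h : (fromBlocks A B C D)ᴴ * Jmat n * fromBlocks A B C D = Jmat n)
    (hB : IsUnit B) {x x' u' : Fin n → ℂ} (hx : x = A *ᵥ x' + B *ᵥ u') :
    star x' ⬝ᵥ ((Cᴴ * A) *ᵥ x') + 2 * ((star x' ⬝ᵥ ((Cᴴ * B) *ᵥ u')).re : ℂ)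
      + star u' ⬝ᵥ ((Dᴴ * B) *ᵥ u')
    = -(star x ⬝ᵥ (-(D * B⁻¹)) *ᵥ x - (star x' ⬝ᵥ (-B⁻¹) *ᵥ x + star x ⬝ᵥ (-B⁻¹)ᴴ *ᵥ x')
        + star x' ⬝ᵥ (-(B⁻¹ * A)) *ᵥ x') := by
  obtain ⟨hP, hR, h3⟩ := rs_loc h hB
  obtain ⟨h1, -, -⟩ := rs_blocks h
  have h1' := congrArg Matrix.conjTranspose h1
  simp only [Matrix.conjTranspose_sub, Matrix.conjTranspose_mul, Matrix.conjTranspose_conjTranspose,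
      Matrix.conjTranspose_one] at h1'
  have hb : IsUnit B.det := (Matrix.isUnit_iff_isUnit_det _).1 hB
  have hc : C *ᵥ x' + D *ᵥ u' = -((-(D * B⁻¹)) *ᵥ x) + (-B⁻¹)ᴴ *ᵥ x' := by
    rw [← h3, hx]
    simp only [sub_mulVec, mulVec_add, neg_mulVec, mulVec_mulVec, Matrix.neg_mul, Matrix.mul_assoc,
      Matrix.nonsing_inv_mul _ hb, Matrix.mul_one]
    abel
  have hu : u' = -((-B⁻¹) *ᵥ x) + (-(B⁻¹ * A)) *ᵥ x' := by
    rw [hx]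
    simp only [mulVec_add, neg_mulVec, mulVec_mulVec, Matrix.neg_mul,
      Matrix.nonsing_inv_mul _ hb, Matrix.one_mulVec]
    abel
  have hre : 2 * ((star x' ⬝ᵥ ((Cᴴ * B) *ᵥ u')).re : ℂ) =
      star x' ⬝ᵥ ((Cᴴ * B) *ᵥ u') + star u' ⬝ᵥ ((Bᴴ * C) *ᵥ x') := by
    have e : star u' ⬝ᵥ ((Bᴴ * C) *ᵥ x') = star (star x' ⬝ᵥ ((Cᴴ * B) *ᵥ u')) := by
      rw [Matrix.star_dotProduct, rs_adj,
        Matrix.conjTranspose_mul, Matrix.conjTranspose_conjTranspose]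
    rw [e, Complex.star_def, Complex.add_conj]
    push_cast; ring
  have hBC : Bᴴ * C = Dᴴ * A - 1 := by rw [← h1']; abel
  have hL : star x' ⬝ᵥ ((Cᴴ * A) *ᵥ x') + 2 * ((star x' ⬝ᵥ ((Cᴴ * B) *ᵥ u')).re : ℂ)
      + star u' ⬝ᵥ ((Dᴴ * B) *ᵥ u') = star (C *ᵥ x' + D *ᵥ u') ⬝ᵥ x - star u' ⬝ᵥ x' := by
    rw [hre, hBC, hx]
    simp only [star_add, add_dotProduct, rs_adj, sub_mulVec, mulVec_add, dotProduct_add,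
      dotProduct_sub, one_mulVec, mulVec_mulVec]
    ring
  rw [hL, hc]
  have e2 : star u' ⬝ᵥ x' = -(star x ⬝ᵥ (-B⁻¹)ᴴ *ᵥ x') + star x' ⬝ᵥ (-(B⁻¹ * A)) *ᵥ x' := by
    conv_lhs => rw [hu]
    rw [star_add, star_neg, add_dotProduct, neg_dotProduct, rs_adj, rs_adj, hR.eq]
  rw [e2, star_add, star_neg, add_dotProduct, neg_dotProduct, rs_adj, rs_adj, hP.eq,
    Matrix.conjTranspose_conjTranspose]
  ring

lemma rs_exists_sol (Q : ℕ → Matrix (Fin n ⊕ Fin n) (Fin n ⊕ Fin n) ℂ) (hQ : ∀ k, IsUnit (Q k))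
    (m : ℕ) : ∀ Z0 : Matrix (Fin n ⊕ Fin n) (Fin n) ℂ,
    ∃ Z : ℕ → Matrix (Fin n ⊕ Fin n) (Fin n) ℂ, Z m = Z0 ∧ ∀ k, Z k = Q k * Z (k + 1) := by
  have hd : ∀ k, IsUnit (Q k).det := fun k => (Matrix.isUnit_iff_isUnit_det _).1 (hQ k)
  induction m with
  | zero =>
    intro Z0
    refine ⟨fun k => Nat.rec Z0 (fun k z => (Q k)⁻¹ * z) k, rfl, fun k => ?_⟩
    simp only []
    rw [Matrix.mul_nonsing_inv_cancel_left _ _ (hd k)]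
  | succ m ih =>
    intro Z0
    obtain ⟨Z, h1, h2⟩ := ih (Q m * Z0)
    refine ⟨Z, ?_, h2⟩
    have := h2 m
    rw [h1] at this
    have h3 := congrArg ((Q m)⁻¹ * ·) this
    simp only [Matrix.nonsing_inv_mul_cancel_left _ _ (hd m)] at h3
    exact h3.symm

lemma rs_conj_basis (Q : ℕ → Matrix (Fin n ⊕ Fin n) (Fin n ⊕ Fin n) ℂ)
    (hQ : ∀ k, (Q k)ᴴ * Jmat n * Q k = Jmat n) (Z : ℕ → Matrix (Fin n ⊕ Fin n) (Fin n) ℂ)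
    (hZ : ∀ k, Z k = Q k * Z (k + 1)) (m : ℕ) (h1 : (Z m).rank = n)
    (h2 : (Z m)ᴴ * Jmat n * Z m = 0) (k : ℕ) : (Z k).rank = n ∧ (Z k)ᴴ * Jmat n * Z k = 0 := by
  have hr : ∀ k, (Z k).rank = (Z 0).rank := by
    intro k
    induction k with
    | zero => rfl
    | succ k ih =>
      rw [← ih, hZ k, Matrix.rank_mul_eq_right_of_isUnit_det _ _
        ((Matrix.isUnit_iff_isUnit_det _).1 (rs_symp_unit (hQ k)))]
  have hj : ∀ k, (Z k)ᴴ * Jmat n * Z k = (Z 0)ᴴ * Jmat n * Z 0 := by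
    intro k
    induction k with
    | zero => rfl
    | succ k ih =>
      rw [← ih, hZ k, Matrix.conjTranspose_mul]
      have : (Z (k + 1))ᴴ * (Q k)ᴴ * Jmat n * (Q k * Z (k + 1))
        = (Z (k + 1))ᴴ * ((Q k)ᴴ * Jmat n * Q k) * Z (k + 1) := by
        simp only [Matrix.mul_assoc]
      rw [this, hQ]
  exact ⟨by rw [hr k, ← hr m, h1], by rw [hj k, ← hj m, h2]⟩

lemma rs_Snu (S : ℕ → Matrix (Fin n ⊕ Fin n) (Fin n ⊕ Fin n) ℂ)
    (A B C D W : ℕ → Mat) (hS : ∀ k, (S k)ᴴ * Jmat n * S k = Jmat n)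
    (hblocks : ∀ k, S k = Matrix.fromBlocks (A k) (B k) (C k) (D k))
    (hW : ∀ k, (W k).PosDef) (nu : ℝ) (k : ℕ) :
    S k + (nu : ℂ) • Vmat S W k = fromBlocks (A k) (B k)
      (C k + (nu : ℂ) • (W k * A k)) (D k + (nu : ℂ) • (W k * B k)) ∧
    (S k + (nu : ℂ) • Vmat S W k)ᴴ * Jmat n * (S k + (nu : ℂ) • Vmat S W k) = Jmat n := by
  constructor
  · rw [Vmat, hblocks k]
    simp [Jmat, PsiMat, Matrix.fromBlocks_multiply, Matrix.fromBlocks_neg, Matrix.fromBlocks_smul,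
      Matrix.fromBlocks_add]
  · have hE : S k + (nu : ℂ) • Vmat S W k = fromBlocks 1 0 ((nu : ℂ) • W k) 1 * S k := by
      rw [Vmat, hblocks k]
      simp [Jmat, PsiMat, Matrix.fromBlocks_multiply, Matrix.fromBlocks_neg, Matrix.fromBlocks_smul,
        Matrix.fromBlocks_add, add_comm]
    have hEJ : (fromBlocks 1 0 ((nu : ℂ) • W k) 1 : Matrix (Fin n ⊕ Fin n) (Fin n ⊕ Fin n) ℂ)ᴴ
        * Jmat n * fromBlocks 1 0 ((nu : ℂ) • W k) 1 = Jmat n := by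
      simp [Jmat, Matrix.fromBlocks_multiply, Matrix.fromBlocks_conjTranspose, (hW k).1.eq]
    rw [hE, Matrix.conjTranspose_mul]
    conv_rhs => rw [← hS k, ← hEJ]
    simp only [Matrix.mul_assoc]

end system

section final
variable {n : ℕ}

local notation "Mat" => Matrix (Fin n) (Fin n) ℂ

lemma rs_positivity (A B C D W : ℕ → Mat) (nu : ℝ) (M L : ℕ) (hML : M ≤ L)
    (hsym : ∀ k, (fromBlocks (A k) (B k) (C k + (nu : ℂ) • (W k * A k))
        (D k + (nu : ℂ) • (W k * B k)))ᴴ * Jmat n * fromBlocks (A k) (B k)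
        (C k + (nu : ℂ) • (W k * A k)) (D k + (nu : ℂ) • (W k * B k)) = Jmat n)
    (hB : ∀ k, L ≤ k → IsUnit (B k))
    (hdis : ∀ N, M ≤ N → DisconjugateOn A B C D W nu M N)
    (P R G : ℕ → Mat) (hPd : ∀ k, P k = -((D k + (nu : ℂ) • (W k * B k)) * (B k)⁻¹))
    (hRd : ∀ k, R k = -((B k)⁻¹ * A k)) (hGd : ∀ k, G k = -(B k)⁻¹)
    (N : ℕ) (y : ℕ → Fin n → ℂ) (hy : ∀ j, N < j → y j = 0) (hyN : y N ≠ 0) :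
    0 < ∑ j ∈ Finset.range (N + 1), star (y j) ⬝ᵥ (P (L + 1 + j) + R (L + j)) *ᵥ y j
        - ∑ j ∈ Finset.range N, (star (y (j + 1)) ⬝ᵥ G (L + 1 + j) *ᵥ y j
          + star (y j) ⬝ᵥ (G (L + 1 + j))ᴴ *ᵥ y (j + 1)) := by
  set x : ℕ → Fin n → ℂ := fun k => if k ≤ L then 0 else y (k - L - 1) with hx
  have hx0 : ∀ k, k ≤ L → x k = 0 := fun k hk => by simp [hx, hk]
  have hxy : ∀ j, x (L + 1 + j) = y j := by
    intro j
    have h1 : ¬ (L + 1 + j ≤ L) := by omega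
    have h2 : L + 1 + j - L - 1 = j := by omega
    simp only [hx, h1, if_false, h2]
  set u : ℕ → Fin n → ℂ := fun j => (B (j - 1))⁻¹ *ᵥ (x (j - 1) - A (j - 1) *ᵥ x j) with hu
  have hu1 : ∀ k, u (k + 1) = (B k)⁻¹ *ᵥ (x k - A k *ᵥ x (k + 1)) := by
    intro k; simp [hu]
  have hu0 : ∀ k, k < L → u (k + 1) = 0 := by
    intro k hk
    rw [hu1, hx0 k hk.le, hx0 (k + 1) hk]; simp
  have hadm : ∀ k, L ≤ k → x k = A k *ᵥ x (k + 1) + B k *ᵥ u (k + 1) := by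
    intro k hk
    rw [hu1, mulVec_mulVec, Matrix.mul_nonsing_inv _ ((Matrix.isUnit_iff_isUnit_det _).1 (hB k hk)),
      one_mulVec]
    abel
  have hd := hdis (L + 1 + N) (by omega) x u ?_ (hx0 M hML) ?_ ?_
  rotate_left
  · intro k _ _
    rcases le_or_gt L k with hk | hk
    · exact hadm k hk
    · rw [hx0 k hk.le, hx0 (k + 1) hk, hu0 k hk]; simp
  · rw [show L + 1 + N + 1 = L + 1 + (N + 1) by ring, hxy]
    exact hy _ (by omega)
  · exact ⟨L + 1 + N, by omega, by omega, by rwa [hxy]⟩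
  have hF : 0 < Fquad A B C D W nu x u M (L + 1 + N) := by
    rw [Complex.lt_def]
    exact ⟨hd.2, by simpa using hd.1.symm⟩
  refine lt_of_lt_of_eq hF ?_
  set g : ℕ → ℂ := fun k => star (x k) ⬝ᵥ P k *ᵥ x k
    - (star (x (k + 1)) ⬝ᵥ G k *ᵥ x k + star (x k) ⬝ᵥ (G k)ᴴ *ᵥ x (k + 1))
    + star (x (k + 1)) ⬝ᵥ R k *ᵥ x (k + 1) with hg
  have hF1 : Fquad A B C D W nu x u M (L + 1 + N) = ∑ k ∈ Finset.Icc M (L + 1 + N), g k := by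
    rw [Fquad, ← Finset.sum_neg_distrib]
    apply Finset.sum_congr rfl
    intro k _
    rcases le_or_gt L k with hk | hk
    · rw [rs_term (hsym k) (hB k hk) (hadm k hk), neg_neg]
      simp only [hg, hPd, hRd, hGd]
    · simp only [hg, hx0 k hk.le, hx0 (k + 1) hk, hu0 k hk]
      simp
  have hF2 : ∑ k ∈ Finset.Icc M (L + 1 + N), g k = ∑ j ∈ Finset.range (N + 2), g (L + j) := by
    have e1 : Finset.Icc M (L + 1 + N) = Finset.Ico M (L + 1 + N + 1) := by
      ext a; simp [Nat.lt_succ_iff]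
    rw [e1, ← Finset.sum_Ico_consecutive g hML (by omega : L ≤ L + 1 + N + 1)]
    rw [Finset.sum_eq_zero, zero_add, Finset.sum_Ico_eq_sum_range]
    · rw [show L + 1 + N + 1 - L = N + 2 by omega]
    · intro k hk
      have hk := (Finset.mem_Ico.1 hk).2
      simp [hg, hx0 k hk.le, hx0 (k + 1) hk]
  have hg0 : g L = star (y 0) ⬝ᵥ R L *ᵥ y 0 := by
    have := hxy 0
    rw [add_zero] at this
    simp only [hg, hx0 L le_rfl, this]
    simp
  have hgs : ∀ j, g (L + (j + 1)) = star (y j) ⬝ᵥ P (L + 1 + j) *ᵥ y j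
      - (star (y (j + 1)) ⬝ᵥ G (L + 1 + j) *ᵥ y j + star (y j) ⬝ᵥ (G (L + 1 + j))ᴴ *ᵥ y (j + 1))
      + star (y (j + 1)) ⬝ᵥ R (L + (j + 1)) *ᵥ y (j + 1) := by
    intro j
    have e1 : L + (j + 1) = L + 1 + j := by ring
    have e2 : L + 1 + j + 1 = L + 1 + (j + 1) := by ring
    simp only [hg, e1, e2, hxy]
  rw [hF1, hF2, Finset.sum_range_succ', add_zero, hg0]
  simp only [hgs, Finset.sum_add_distrib, Finset.sum_sub_distrib, add_mulVec, dotProduct_add]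
  have hR2 : ∑ j ∈ Finset.range (N + 1), star (y (j + 1)) ⬝ᵥ R (L + (j + 1)) *ᵥ y (j + 1)
      + star (y 0) ⬝ᵥ R L *ᵥ y 0 = ∑ j ∈ Finset.range (N + 1), star (y j) ⬝ᵥ R (L + j) *ᵥ y j := by
    have h1 := Finset.sum_range_succ' (fun j => star (y j) ⬝ᵥ R (L + j) *ᵥ y j) (N + 1)
    have h2 := Finset.sum_range_succ (fun j => star (y j) ⬝ᵥ R (L + j) *ᵥ y j) (N + 1)
    simp only [hy (N + 1) (by omega), add_zero] at h1 h2
    rw [h1] at h2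
    simpa using h2
  have hc1 := Finset.sum_range_succ (fun j => star (y (j + 1)) ⬝ᵥ G (L + 1 + j) *ᵥ y j) N
  have hc2 := Finset.sum_range_succ (fun j => star (y j) ⬝ᵥ (G (L + 1 + j))ᴴ *ᵥ y (j + 1)) N
  simp only [hy (N + 1) (by omega), star_zero, zero_dotProduct, mulVec_zero, dotProduct_zero,
    add_zero] at hc1 hc2
  rw [hc1, hc2, ← hR2]
  ring

lemma rs_wronsk (X U X' U' : Mat) : (fromRows X U)ᴴ * Jmat n * fromRows X' U' = Xᴴ * U' - Uᴴ * X' := by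
  rw [Matrix.mul_assoc, Jmat, Matrix.fromBlocks_mul_fromRows,
    Matrix.conjTranspose_fromRows_eq_fromCols_conjTranspose, Matrix.fromCols_mul_fromRows]
  simp [sub_eq_add_neg]

lemma rs_rank (U : Mat) : (fromRows (1 : Mat) U).rank = n := by
  apply le_antisymm
  · simpa using Matrix.rank_le_card_width (fromRows (1 : Mat) U)
  · have h : (fromCols (1 : Mat) (0 : Mat)) * fromRows (1 : Mat) U = (1 : Mat) := by
      rw [Matrix.fromCols_mul_fromRows]; simp
    have := Matrix.rank_mul_le_right (fromCols (1 : Mat) (0 : Mat)) (fromRows (1 : Mat) U)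
    rw [h, Matrix.rank_one] at this
    simpa using this

end final

/-- Existence of the recessive solution: if `(S_ν)` is nonoscillatory and
eventually controllable, then it possesses a recessive solution `Z̃ = (X̃; Ũ)`. -/
theorem statement13 {n : ℕ} (hn : 1 ≤ n)
    (S : ℕ → Matrix (Fin n ⊕ Fin n) (Fin n ⊕ Fin n) ℂ)
    (A B C D W : ℕ → Matrix (Fin n) (Fin n) ℂ)
    (hS : ∀ k, (S k)ᴴ * Jmat n * S k = Jmat n)
    (hblocks : ∀ k, S k = Matrix.fromBlocks (A k) (B k) (C k) (D k))
    (hW : ∀ k, (W k).PosDef)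
    (nu : ℝ)
    (hnonosc : ∃ M : ℕ, ∀ N, M ≤ N → DisconjugateOn A B C D W nu M N)
    (hctrl : EventuallyControllable B D) :
    ∃ Xt Ut : ℕ → Matrix (Fin n) (Fin n) ℂ, IsRecessive S W B nu Xt Ut := by
  obtain ⟨M, hdis⟩ := hnonosc
  obtain ⟨N0, hN0⟩ := hctrl
  -- eventual controllability makes `B k` invertible for large `k`
  have hBN : ∀ k, N0 ≤ k → IsUnit (B k) := by
    intro k hk
    rw [← Matrix.mulVec_injective_iff_isUnit]
    rw [← Matrix.coe_mulVecLin, ← LinearMap.ker_eq_bot, LinearMap.ker_eq_bot']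
    intro v hv
    rw [Matrix.mulVecLin_apply] at hv
    have := hN0 k (k + 1) hk (Nat.lt_succ_self k) (fun j => if j = k + 1 then v else D k *ᵥ v) ?_
      (k + 1) (Nat.le_succ k) le_rfl
    · simpa using this
    · intro j h1 h2
      obtain rfl : j = k := by omega
      simp [hv]
  obtain ⟨L, hML, hB⟩ : ∃ L, M ≤ L ∧ ∀ k, L ≤ k → IsUnit (B k) :=
    ⟨max M N0, le_max_left _ _, fun k hk => hBN k (le_trans (le_max_right _ _) hk)⟩
  have hSnu := rs_Snu S A B C D W hS hblocks hW nu
  set Q : ℕ → Matrix (Fin n ⊕ Fin n) (Fin n ⊕ Fin n) ℂ := fun k => S k + (nu : ℂ) • Vmat S W k with hQ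
  have hQs : ∀ k, (Q k)ᴴ * Jmat n * Q k = Jmat n := fun k => (hSnu k).2
  have hQb : ∀ k, Q k = fromBlocks (A k) (B k)
      (C k + (nu : ℂ) • (W k * A k)) (D k + (nu : ℂ) • (W k * B k)) := fun k => (hSnu k).1
  have hsym : ∀ k, (fromBlocks (A k) (B k) (C k + (nu : ℂ) • (W k * A k))
        (D k + (nu : ℂ) • (W k * B k)))ᴴ * Jmat n * fromBlocks (A k) (B k)
        (C k + (nu : ℂ) • (W k * A k)) (D k + (nu : ℂ) • (W k * B k)) = Jmat n := by
    intro k; rw [← hQb]; exact hQs k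
  obtain ⟨P, hPd⟩ : ∃ P : ℕ → Matrix (Fin n) (Fin n) ℂ,
    ∀ k, P k = -((D k + (nu : ℂ) • (W k * B k)) * (B k)⁻¹) := ⟨_, fun _ => rfl⟩
  obtain ⟨R, hRd⟩ : ∃ R : ℕ → Matrix (Fin n) (Fin n) ℂ, ∀ k, R k = -((B k)⁻¹ * A k) :=
    ⟨_, fun _ => rfl⟩
  obtain ⟨G, hGd⟩ : ∃ G : ℕ → Matrix (Fin n) (Fin n) ℂ, ∀ k, G k = -(B k)⁻¹ := ⟨_, fun _ => rfl⟩
  have hposi := rs_positivity A B C D W nu M L hML hsym hB hdis P R G hPd hRd hGd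
  have hPH : ∀ k, L ≤ k → (P k).IsHermitian := fun k hk => by
    rw [hPd]; exact (rs_loc (hsym k) (hB k hk)).1
  have hRH : ∀ k, L ≤ k → (R k).IsHermitian := fun k hk => by
    rw [hRd]; exact (rs_loc (hsym k) (hB k hk)).2.1
  have hGu : ∀ k, L ≤ k → IsUnit (G k) := fun k hk => by
    rw [hGd]; exact (Matrix.isUnit_nonsing_inv_iff.2 (hB k hk)).neg
  -- relations for solutions
  have hsol : ∀ X U : ℕ → Matrix (Fin n) (Fin n) ℂ,
      (∀ k, fromRows (X k) (U k) = Q k * fromRows (X (k + 1)) (U (k + 1))) → ∀ k, L ≤ k →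
      (G k)ᴴ * X (k + 1) = U k + P k * X k ∧ U (k + 1) = -(G k * X k) + R k * X (k + 1) := by
    intro X U h k hk
    have hk1 := h k
    rw [hQb, Matrix.fromBlocks_mul_fromRows, Matrix.fromRows_inj.eq_iff] at hk1
    obtain ⟨h1, h2⟩ := hk1
    rw [hGd, hPd, hRd]
    exact rs_sol (hsym k) (hB k hk) h1 h2
  set m := L + 1 with hm
  set T : ℕ → Matrix (Fin n) (Fin n) ℂ := fun j => P (m + j) + R (L + j) with hT
  set g : ℕ → Matrix (Fin n) (Fin n) ℂ := fun j => G (m + j) with hgdef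
  have hTH : ∀ j, (T j).IsHermitian := fun j => (hPH _ (by omega)).add (hRH _ (by omega))
  have hgu : ∀ j, IsUnit (g j) := fun j => hGu _ (by omega)
  have hpiv : ∀ k, (rsP T g k).PosDef := fun k => (rs_pivot_form T g hTH hposi k).1
  obtain ⟨H, hHp, hHrec, hHlim⟩ := rs_limit T g hgu hpiv
  obtain ⟨Z, hZm, hZ⟩ := rs_exists_sol Q (fun k => rs_symp_unit (hQs k)) m
    (fromRows 1 (H 0 - P m))
  obtain ⟨Xt, hXt⟩ : ∃ Xt : ℕ → Matrix (Fin n) (Fin n) ℂ, ∀ k, Xt k = (Z k).toRows₁ :=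
    ⟨_, fun _ => rfl⟩
  obtain ⟨Ut, hUt⟩ : ∃ Ut : ℕ → Matrix (Fin n) (Fin n) ℂ, ∀ k, Ut k = (Z k).toRows₂ :=
    ⟨_, fun _ => rfl⟩
  have hZe : ∀ k, fromRows (Xt k) (Ut k) = Z k := fun k => by
    rw [hXt, hUt, Matrix.fromRows_toRows]
  have hX0 : Xt m = 1 := by rw [hXt, hZm, Matrix.toRows₁_fromRows]
  have hU0 : Ut m = H 0 - P m := by rw [hUt, hZm, Matrix.toRows₂_fromRows]
  have hZt : ∀ k, fromRows (Xt k) (Ut k) = Q k * fromRows (Xt (k + 1)) (Ut (k + 1)) := by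
    intro k; rw [hZe, hZe]; exact hZ k
  have hsolt := hsol Xt Ut hZt
  have hdet : ∀ {K : Matrix (Fin n) (Fin n) ℂ}, IsUnit K → IsUnit K.det :=
    fun h => (Matrix.isUnit_iff_isUnit_det _).1 h
  -- the solution follows the limiting Riccati sequence
  have hric : ∀ j, IsUnit (Xt (m + j)) ∧ Ut (m + j) = (H j - P (m + j)) * Xt (m + j) := by
    intro j
    induction j with
    | zero =>
      rw [add_zero, hX0, hU0]
      exact ⟨isUnit_one, by rw [Matrix.mul_one]⟩
    | succ j ih =>
      obtain ⟨h1, h2⟩ := hsolt (m + j) (by omega)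
      have h3 : (g j)ᴴ * Xt (m + j + 1) = H j * Xt (m + j) := by
        rw [hgdef]; simp only []
        rw [h1, ih.2, ← Matrix.add_mul, sub_add_cancel]
      rw [← add_assoc]
      constructor
      · have hu : IsUnit ((g j)ᴴ * Xt (m + j + 1)) := by
          rw [h3]; exact (hHp j).isUnit.mul ih.1
        rw [Matrix.isUnit_iff_isUnit_det, Matrix.det_mul] at hu
        exact (Matrix.isUnit_iff_isUnit_det _).2 (isUnit_of_mul_isUnit_right hu)
      · have h4 : H (j + 1) - P (m + j + 1) = R (m + j) - g j * (H j)⁻¹ * (g j)ᴴ := by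
          rw [hHrec j, hT]
          simp only []
          rw [show L + (j + 1) = m + j by omega, ← add_assoc]
          abel
        rw [h2, h4, Matrix.sub_mul, Matrix.mul_assoc _ _ (Xt (m + j + 1)), h3, Matrix.mul_assoc,
          Matrix.nonsing_inv_mul_cancel_left _ _ (hdet (hHp j).isUnit)]
        abel
  have hgX : ∀ j, (g j)ᴴ * Xt (m + (j + 1)) = H j * Xt (m + j) := by
    intro j
    obtain ⟨h1, h2⟩ := hsolt (m + j) (by omega)
    rw [← add_assoc, hgdef]; simp only []
    rw [h1, (hric j).2, ← Matrix.add_mul, sub_add_cancel]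
  set e : ℕ → Matrix (Fin n) (Fin n) ℂ := fun j => (Xt (m + j))ᴴ * H j * Xt (m + j) with he
  have hep : ∀ j, (e j).PosDef := fun j => rs_conj (hHp j) (hric j).1
  have hXg : ∀ j, (Xt (m + (j + 1)))ᴴ * g j * Xt (m + j) = e j := by
    intro j
    have := congrArg Matrix.conjTranspose (hgX j)
    rw [Matrix.conjTranspose_mul, Matrix.conjTranspose_mul, Matrix.conjTranspose_conjTranspose,
      (hHp j).1.eq] at this
    rw [this]
  have hXg' : ∀ j, (Xt (m + j))ᴴ * (g j)ᴴ * Xt (m + (j + 1)) = e j := by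
    intro j
    rw [Matrix.mul_assoc, hgX, ← Matrix.mul_assoc]
  have hlim0 : Tendsto (fun l => (∑ j ∈ Finset.range (l + 1), (e j)⁻¹)⁻¹) atTop (nhds 0) := by
    have h1 := rs_sum_id T g H (fun j => Xt (m + j)) hHp hHrec (fun j => (hric j).1) hgX
    have h2 : ∀ l, (∑ j ∈ Finset.range (l + 1), (e j)⁻¹)⁻¹ = H 0 - rsB T g l 0 := by
      intro l
      have := h1 l 0
      simp only [add_zero, hX0, Matrix.conjTranspose_one, Matrix.one_mul, Matrix.mul_one,
        zero_add] at this
      rw [this]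
    simp only [h2]
    have := (hHlim 0).const_sub (H 0)
    rwa [sub_self] at this
  refine ⟨Xt, Ut, ⟨hZt, ?_⟩, ⟨m, ?_⟩, ?_⟩
  · intro k
    simp only [hZe]
    refine rs_conj_basis Q hQs Z hZ m ?_ ?_ k
    · rw [hZm]; exact rs_rank _
    · rw [hZm, rs_wronsk, Matrix.conjTranspose_sub, (hHp 0).1.eq, (hPH m (by omega)).eq]
      simp
  · intro k hk
    obtain ⟨j, rfl⟩ := Nat.exists_eq_add_of_le hk
    refine ⟨(hric j).1, ?_⟩
    have h1 : -((Xt (m + j))⁻¹ * B (m + j) * ((Xt (m + j + 1))ᴴ)⁻¹) = (e j)⁻¹ := by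
      have hgi : B (m + j) = -(g j)⁻¹ := by
        symm
        rw [neg_eq_iff_eq_neg]
        apply Matrix.inv_eq_right_inv
        rw [hgdef]; simp only []
        rw [hGd, neg_mul_neg, Matrix.nonsing_inv_mul _ (hdet (hB _ (by omega)))]
      rw [← hXg, Matrix.mul_inv_rev, Matrix.mul_inv_rev, hgi, ← add_assoc]
      simp only [Matrix.mul_neg, Matrix.neg_mul, neg_neg, Matrix.mul_assoc]
    rw [h1]
    exact (hep j).inv.posSemidef
  · intro X U hXU hnorm
    have hsolX := hsol X U hXU.1
    set Y : ℕ → Matrix (Fin n) (Fin n) ℂ := fun j => (Xt (m + j))⁻¹ * X (m + j) with hY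
    have hXY : ∀ j, X (m + j) = Xt (m + j) * Y j := fun j => by
      rw [hY]; simp only []
      rw [Matrix.mul_nonsing_inv_cancel_left _ _ (hdet (hric j).1)]
    have hstep : ∀ j, Y (j + 1) = Y j - (e j)⁻¹ := by
      intro j
      have hw := congrArg Matrix.conjTranspose (hnorm (m + j))
      rw [rs_wronsk] at hw
      simp only [Matrix.conjTranspose_sub, Matrix.conjTranspose_mul,
        Matrix.conjTranspose_conjTranspose, Matrix.conjTranspose_one] at hw
      have h1 := (hsolX (m + j) (by omega)).1
      have h2 : U (m + j) = (g j)ᴴ * X (m + (j + 1)) - P (m + j) * X (m + j) := by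
        rw [← add_assoc, hgdef]; simp only []
        rw [h1]; abel
      have h3 : Ut (m + j) = (g j)ᴴ * Xt (m + (j + 1)) - P (m + j) * Xt (m + j) := by
        rw [hgX, (hric j).2, Matrix.sub_mul]
      have hPh := (hPH (m + j) (by omega)).eq
      have h4 : e j * Y (j + 1) - e j * Y j = -1 := by
        rw [← hw, h2, h3]
        rw [Matrix.conjTranspose_sub, Matrix.conjTranspose_mul, Matrix.conjTranspose_mul,
          Matrix.conjTranspose_conjTranspose, hPh]
        rw [Matrix.sub_mul, Matrix.mul_sub]
        rw [hXY (j + 1), ← Matrix.mul_assoc _ (g j)ᴴ, ← Matrix.mul_assoc _ (Xt (m + (j + 1))),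
          hXg']
        rw [hXY j, ← Matrix.mul_assoc _ (Xt (m + j)) (Y j), hXg]
        simp only [Matrix.mul_assoc]
        abel
      have hei := hdet (hep j).isUnit
      have h5 : e j * Y (j + 1) = e j * Y j - 1 := by
        rw [← sub_eq_zero, ← sub_eq_zero.2 h4]; abel
      have h6 := congrArg ((e j)⁻¹ * ·) h5
      simp only [Matrix.mul_sub, Matrix.nonsing_inv_mul_cancel_left _ _ hei, Matrix.mul_one] at h6
      exact h6
    have hYs : ∀ l, Y l = Y 0 - ∑ j ∈ Finset.range l, (e j)⁻¹ := by
      intro l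
      induction l with
      | zero => simp
      | succ l ih => rw [hstep, ih, Finset.sum_range_succ]; abel
    have hsu : ∀ l, IsUnit (∑ j ∈ Finset.range (l + 1), (e j)⁻¹) := fun l => by
      have := (rs_posDef_sum e hep l 0).isUnit
      simpa using this
    obtain ⟨hc1, hc2⟩ := rs_div _ (Y 0) hsu hlim0
    simp only [← hYs] at hc1 hc2
    constructor
    · obtain ⟨l0, hl0⟩ := eventually_atTop.1 hc1
      refine ⟨m + (l0 + 1), fun k hk => ?_⟩
      obtain ⟨j, rfl⟩ := Nat.exists_eq_add_of_le hk
      rw [show m + (l0 + 1) + j = m + (l0 + j + 1) by ring, hXY]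
      exact (hric _).1.mul (hl0 (l0 + j) (by omega))
    · rw [← tendsto_add_atTop_iff_nat (m + 1)]
      refine hc2.congr fun l => ?_
      have hfin : (X (m + (l + 1)))⁻¹ * Xt (m + (l + 1)) = (Y (l + 1))⁻¹ := by
        rw [hXY]
        generalize Y (l + 1) = y
        rw [Matrix.mul_inv_rev, Matrix.nonsing_inv_mul_cancel_right _ _ (hdet (hric _).1)]
      rw [show l + (m + 1) = m + (l + 1) by ring]
      exact hfin.symm
end
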